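/- Let k be a field, A a finite-dimensional self-injective k-algebra, and M a finitely generated A-module that is a generator, self-orthogonal and Nakayama-stable. Then every module X ∈ ℰ ∩ 𝒮 is M-compact, and there exist an M-filtered A-module X' and projective A-modules P, Q with X ⊕ P ≅ X' ⊕ Q (X is stably isomorphic to an M-filtered module). Moreover, a module X ∈ ℰ ∩ 𝒮 is finitely generated if and only if X ∈ add(M). (Proposition 1.6(1).) -/

import Mathlib

open CategoryTheory
/-! ## Additive closure classes -/

section AddClosure

variable (A : Type) [Ring A]

/-- `X ∈ add M`: `X` is a direct summand of a finite direct sum of copies of `M`. -/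
def MemAdd (M X : ModuleCat.{0} A) : Prop :=
  ∃ (n : ℕ) (Y : ModuleCat.{0} A), Nonempty ((↥X × ↥Y) ≃ₗ[A] (Fin n → ↥M))

/-- `X ∈ Add M`: `X` is a direct summand of an arbitrary direct sum of copies of `M`. -/
def MemAddBig (M X : ModuleCat.{0} A) : Prop :=
  ∃ (I : Type) (Y : ModuleCat.{0} A), Nonempty ((↥X × ↥Y) ≃ₗ[A] (I →₀ ↥M))

/-- a morphism of `A`-modules factors through a projective module -/
def FactorsThroughProj {X Y : ModuleCat.{0} A} (f : X ⟶ Y) : Prop :=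
  ∃ (P : ModuleCat.{0} A) (_ : Module.Projective A P) (g : X ⟶ P) (h : P ⟶ Y), f = g ≫ h

/-- a morphism of `A`-modules factors through a module in `Add M` -/
def FactorsThroughAddM (M : ModuleCat.{0} A) {X Y : ModuleCat.{0} A} (f : X ⟶ Y) : Prop :=
  ∃ (Z : ModuleCat.{0} A) (_ : MemAddBig A M Z) (g : X ⟶ Z) (h : Z ⟶ Y), f = g ≫ h

/-- `X ∈ add M` for unbundled modules. -/
def MemAddPlain (M : Type) [AddCommGroup M] [Module A M]
    (X : Type) [AddCommGroup X] [Module A X] : Prop :=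
  ∃ (n : ℕ) (Y : ModuleCat.{0} A), Nonempty ((X × ↥Y) ≃ₗ[A] (Fin n → M))

end AddClosure

/-! ## Ext vanishing -/

section ExtDefs

variable (A : Type) [Ring A]

/-- vanishing of `Ext^n_A(X, Y)` -/
noncomputable def extZero (n : ℕ) (X Y : ModuleCat.{0} A) : Prop :=
  Subsingleton (((Ext ℤ (ModuleCat.{0} A) n).obj (Opposite.op X)).obj Y)

/-- `M` is self-orthogonal: `Ext^n_A(M,M) = 0` for all `n ≥ 1`. -/
noncomputable def SelfOrthogonal (M : ModuleCat.{0} A) : Prop :=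
  ∀ n : ℕ, 1 ≤ n → extZero A n M M

/-- `M` is a generator for `A`-mod: `A ∈ add M`. -/
def IsGen (M : ModuleCat.{0} A) : Prop :=
  MemAdd A M (ModuleCat.of A A)

/-- membership in the `M`-Gorenstein subcategory `𝒢`:
`Ext^n_A(M,X) = 0 = Ext^n_A(X,M)` for all `n ≥ 1`. -/
noncomputable def MemG (M X : ModuleCat.{0} A) : Prop :=
  ∀ n : ℕ, 1 ≤ n → extZero A n M X ∧ extZero A n X M

end ExtDefs

/-! ## The Nakayama functor `ν_A = D ∘ Hom_A(-, A)` -/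

section Nakayama

variable (k A : Type) [Field k] [Ring A] [Algebra k A]

/-- Right multiplication by `a : A` on `Hom_A(X, A)`, as a `k`-linear map. -/
@[simps] def rmulHom (X : Type) [AddCommGroup X] [Module A X] (a : A) :
    (X →ₗ[A] A) →ₗ[k] (X →ₗ[A] A) where
  toFun f :=
    { toFun := fun x => f x * a
      map_add' := fun x y => by simp [add_mul]
      map_smul' := fun c x => by simp [mul_assoc] }
  map_add' f g := by ext x; simp [add_mul]
  map_smul' c f := by ext x; simp [Algebra.smul_def, mul_assoc]

/-- The carrier of the Nakayama functor value `ν_A(X) = D(Hom_A(X,A))`,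
where `D = Hom_k(-,k)`. -/
abbrev NuCarrier (X : Type) [AddCommGroup X] [Module A X] : Type :=
  (X →ₗ[A] A) →ₗ[k] k

/-- The left `A`-module structure on `ν_A(X) = D(Hom_A(X,A))`: `(a • φ) f = φ (f · a)`. -/
instance (X : Type) [AddCommGroup X] [Module A X] : Module A (NuCarrier k A X) where
  smul a φ := φ.comp (rmulHom k A X a)
  one_smul φ := by
    refine LinearMap.ext fun f => ?_
    exact congrArg φ (by ext x; simp)
  mul_smul a b φ := by
    refine LinearMap.ext fun f => ?_
    exact congrArg φ (by ext x; simp [mul_assoc])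
  smul_zero a := rfl
  smul_add a φ ψ := rfl
  add_smul a b φ := by
    refine LinearMap.ext fun f => ?_
    show φ ((rmulHom k A X (a + b)) f) = φ ((rmulHom k A X a) f) + φ ((rmulHom k A X b) f)
    rw [show (rmulHom k A X (a + b)) f = (rmulHom k A X a) f + (rmulHom k A X b) f from by
      ext x; simp [mul_add]]
    exact map_add φ _ _
  zero_smul φ := by
    refine LinearMap.ext fun f => ?_
    show φ ((rmulHom k A X 0) f) = 0
    rw [show (rmulHom k A X 0) f = 0 from by ext x; simp]
    exact map_zero φ

/-- The Nakayama functor value `ν_A(X)` as an object of `ModuleCat A`. -/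
noncomputable def NuMod (X : ModuleCat.{0} A) : ModuleCat.{0} A :=
  ModuleCat.of A (NuCarrier k A ↥X)

/-- `M` is Nakayama-stable: `add M = add (ν_A M)`. -/
noncomputable def NakayamaStable (M : ModuleCat.{0} A) : Prop :=
  ∀ X : ModuleCat.{0} A, MemAdd A M X ↔ MemAdd A (NuMod k A M) X

end Nakayama

/-! ## Central scalars and finite-dimensionality of stable Homs -/

section Central

variable (k A : Type) [Field k] [Ring A] [Algebra k A]

/-- the `A`-linear endomorphism given by the action of the central element
`algebraMap k A c`. -/
def centralSmulLin (c : k) (X : Type) [AddCommGroup X] [Module A X] : X →ₗ[A] X where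
  toFun x := algebraMap k A c • x
  map_add' x y := smul_add _ x y
  map_smul' a x := by
    simp only [RingHom.id_apply, smul_smul, Algebra.commutes]

/-- `StHom_A(X, Y) = Hom_A(X,Y)/(morphisms factoring through projectives)` is
finite-dimensional over `k`: there are finitely many morphisms `f j` such that any
morphism agrees with a `k`-linear combination of the `f j` up to a morphism factoring
through a projective module. -/
def StHomProjFinDim (X Y : ModuleCat.{0} A) : Prop :=
  ∃ (m : ℕ) (f : Fin m → (X ⟶ Y)),
    ∀ g : X ⟶ Y, ∃ c : Fin m → k,
      FactorsThroughProj A (g - ∑ j, (ModuleCat.ofHom (centralSmulLin k A (c j) ↥X : ↥X →ₗ[A] ↥X) ≫ f j))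

end Central

/-! ## Minimal injective coresolutions, cosyzygies, `M`-filtered modules -/

section Cosyzygy

variable (A : Type) [Ring A]

/-- `ι : N ⟶ I` is an injective envelope: `I` is injective, `ι` is injective,
and the image of `ι` is an essential submodule of `I`. -/
def IsInjEnvelope {N I : ModuleCat.{0} A} (ι : N ⟶ I) : Prop :=
  Module.Injective A ↥I ∧ Function.Injective ι ∧
    ∀ K : Submodule A ↥I, K ⊓ LinearMap.range ι.hom = ⊥ → K = ⊥

/-- `C` is the sequence of cosyzygies of `M` along a minimal injective coresolution:
`C 0 ≅ M` and for each `n` there is a short exact sequence `0 → C n → I → C (n+1) → 0`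
in which `C n → I` is an injective envelope. -/
def IsMinInjCoresolution (M : ModuleCat.{0} A) (C : ℕ → ModuleCat.{0} A) : Prop :=
  Nonempty (C 0 ≅ M) ∧
    ∀ n, ∃ (I : ModuleCat.{0} A) (ι : C n ⟶ I) (p : I ⟶ C (n + 1)),
      IsInjEnvelope A ι ∧ Function.Surjective p ∧ LinearMap.range ι.hom = LinearMap.ker p.hom

/-- the family of modules `{A} ∪ {C i | i ∈ ℕ}`, indexed by `Option ℕ`. -/
def optPick (C : ℕ → ModuleCat.{0} A) : Option ℕ → ModuleCat.{0} A
  | none => ModuleCat.of A A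
  | some i => C i

/-- `Q` is isomorphic to a finite direct sum of modules from `{A} ∪ {C i | i ∈ ℕ}`. -/
def IsFinSumFrom (C : ℕ → ModuleCat.{0} A) (Q : Type) [AddCommGroup Q] [Module A Q] : Prop :=
  ∃ (m : ℕ) (T : Fin m → Option ℕ),
    Nonempty (Q ≃ₗ[A] ((j : Fin m) → ↥(optPick A C (T j))))

/-- `X` is `M`-filtered (where `C` encodes the cosyzygies `Ω_A^{-i}(M)`, `C 0 ≅ M`):
there is an ascending chain `0 = X₀ ⊆ X₁ ⊆ ⋯` of submodules with union `X` all of whose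
subquotients are finite direct sums of modules from `{A} ∪ {Ω_A^{-i}(M) | i ∈ ℕ}`. -/
def MFiltered (C : ℕ → ModuleCat.{0} A) (X : ModuleCat.{0} A) : Prop :=
  ∃ F : ℕ → Submodule A ↥X,
    Monotone F ∧ F 0 = ⊥ ∧ (⨆ n, F n) = ⊤ ∧
      ∀ n, IsFinSumFrom A C
        (↥(F (n + 1)) ⧸ (Submodule.comap (F (n + 1)).subtype (F n)))

/-- `X` is finitely `M`-filtered: as `MFiltered`, with a chain that reaches `⊤`
after finitely many steps. -/
def FinMFiltered (C : ℕ → ModuleCat.{0} A) (X : ModuleCat.{0} A) : Prop :=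
  ∃ F : ℕ → Submodule A ↥X,
    Monotone F ∧ F 0 = ⊥ ∧ (∃ n, F n = ⊤) ∧
      ∀ n, IsFinSumFrom A C
        (↥(F (n + 1)) ⧸ (Submodule.comap (F (n + 1)).subtype (F n)))

end Cosyzygy

/-! ## Relative stable Hom-groups and `M`-compact objects -/

section StableM

variable (A : Type) [Ring A]

/-- the subgroup of `Hom_A(X,Y)` generated by morphisms factoring through `Add M` -/
def addMSub (M X Y : ModuleCat.{0} A) : AddSubgroup (X ⟶ Y) :=
  AddSubgroup.closure {f : X ⟶ Y | FactorsThroughAddM A M f}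

/-- the relative stable Hom-group `StHom_M(X,Y) = Hom_A(X,Y)/[M]` -/
def StHomM (M X Y : ModuleCat.{0} A) : Type :=
  (X ⟶ Y) ⧸ addMSub A M X Y

instance (M X Y : ModuleCat.{0} A) : AddCommGroup (StHomM A M X Y) :=
  inferInstanceAs (AddCommGroup ((X ⟶ Y) ⧸ addMSub A M X Y))

/-- postcomposition as an additive map on Hom-groups. -/
def postCompHom {Y Z : ModuleCat.{0} A} (X : ModuleCat.{0} A) (h : Y ⟶ Z) :
    (X ⟶ Y) →+ (X ⟶ Z) :=
  AddMonoidHom.mk' (fun f => f ≫ h) (fun f g => by simp [Preadditive.add_comp])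

/-- postcomposition descends to the relative stable Hom-groups. -/
def stPostComp (M : ModuleCat.{0} A) (X : ModuleCat.{0} A) {Y Z : ModuleCat.{0} A}
    (h : Y ⟶ Z) : StHomM A M X Y →+ StHomM A M X Z :=
  QuotientAddGroup.map _ _ (postCompHom A X h) (by
    rw [addMSub, AddSubgroup.closure_le]
    rintro f ⟨W, hW, u, v, rfl⟩
    rw [SetLike.mem_coe, AddSubgroup.mem_comap]
    exact AddSubgroup.subset_closure ⟨W, hW, u, v ≫ h, by simp [postCompHom]⟩)

/-- the canonical map `⊕ᵢ StHom_M(X, Y i) → StHom_M(X, ⊕ᵢ Y i)`. -/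
noncomputable def stCanonMap (M X : ModuleCat.{0} A) (I : Type) (Y : I → ModuleCat.{0} A) :
    DirectSum I (fun i => StHomM A M X (Y i)) →+ StHomM A M X (∐ Y) :=
  letI : DecidableEq I := Classical.decEq I
  DirectSum.toAddMonoid fun i => stPostComp A M X (Limits.Sigma.ι Y i)

/-- `X` is `M`-compact: `X ∈ 𝒢` and for every family `(Y i)` in `𝒢` the canonical map
`⊕ᵢ StHom_M(X, Y i) → StHom_M(X, ⊕ᵢ Y i)` is bijective. -/
noncomputable def MCompact (M X : ModuleCat.{0} A) : Prop :=
  MemG A M X ∧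
    ∀ (I : Type) (Y : I → ModuleCat.{0} A), (∀ i, MemG A M (Y i)) →
      Function.Bijective (stCanonMap A M X I Y)

end StableM

/-! ## The class `𝒮` -/

section SClass

variable (A : Type) [Ring A]

/-- the closure properties defining the class `𝒮`: contains `M`, closed under
isomorphisms, direct summands, arbitrary direct sums, and satisfies two-out-of-three
for short exact sequences. -/
def IsSClosedClass (M : ModuleCat.{0} A) (P : ModuleCat.{0} A → Prop) : Prop :=
  P M ∧
  (∀ X Y : ModuleCat.{0} A, P X → Nonempty (X ≅ Y) → P Y) ∧
  (∀ X Y : ModuleCat.{0} A, P Y → (∃ (i : X ⟶ Y) (r : Y ⟶ X), i ≫ r = 𝟙 X) → P X) ∧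
  (∀ (I : Type) (Y : I → ModuleCat.{0} A), (∀ i, P (Y i)) → P (∐ Y)) ∧
  (∀ (X Y Z : ModuleCat.{0} A) (f : X ⟶ Y) (g : Y ⟶ Z),
    Function.Injective f → Function.Surjective g → LinearMap.range f.hom = LinearMap.ker g.hom →
      ((P X ∧ P Y → P Z) ∧ (P X ∧ P Z → P Y) ∧ (P Y ∧ P Z → P X)))

/-- `𝒮` is the smallest class containing `M`, closed under isomorphisms, direct
summands and direct sums, with the two-out-of-three property. -/
def MemS (M X : ModuleCat.{0} A) : Prop :=
  ∀ P : ModuleCat.{0} A → Prop, IsSClosedClass A M P → P X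

end SClass

/-! ## The class `ℰ` -/

section EClass

variable (k A : Type) [Field k] [Ring A] [Algebra k A]

/-- `X ∈ ℰ`: `X ∈ 𝒢` and the stable Homs `StHom_A(M,X)`, `StHom_A(Ω_A^{-1}(M),X)` are
finite-dimensional over `k`; here `Om1` stands for the first cosyzygy `Ω_A^{-1}(M)`. -/
noncomputable def MemE (M Om1 X : ModuleCat.{0} A) : Prop :=
  MemG A M X ∧ StHomProjFinDim k A M X ∧ StHomProjFinDim k A Om1 X

end EClass


/-! ## Maps factoring through projective modules -/

section StableNull

variable {A : Type} [Ring A]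
variable {X Y Z P Q T X' Y' T' : Type} [AddCommGroup X] [Module A X] [AddCommGroup Y] [Module A Y]
  [AddCommGroup Z] [Module A Z] [AddCommGroup P] [Module A P] [AddCommGroup Q] [Module A Q]
  [AddCommGroup T] [Module A T] [AddCommGroup X'] [Module A X'] [AddCommGroup Y'] [Module A Y'] [AddCommGroup T']
  [Module A T']

/-- Unbundled form of the extension property of injective modules. -/
theorem exists_extension [Module.Injective A Q] {i : X →ₗ[A] Y} (hi : Function.Injective i)
    (f : X →ₗ[A] Q) : ∃ g : Y →ₗ[A] Q, g ∘ₗ i = f := by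
  obtain ⟨g, hg⟩ := Module.Injective.out i hi f
  exact ⟨g, LinearMap.ext hg⟩

theorem injective_of_retract [Module.Injective A Q] (i : P →ₗ[A] Q) (r : Q →ₗ[A] P)
    (h : r ∘ₗ i = LinearMap.id) : Module.Injective A P where
  out X Y _ _ _ _ f hf g := by
    obtain ⟨u, hu⟩ := exists_extension (A := A) hf (i ∘ₗ g)
    refine ⟨r ∘ₗ u, fun x => ?_⟩
    have h1 := LinearMap.congr_fun hu x
    have h2 := LinearMap.congr_fun h (g x)
    simp only [LinearMap.comp_apply, LinearMap.id_apply] at h1 h2 ⊢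
    rw [h1, h2]

/-- Over a Noetherian ring a direct sum of copies of an injective module is injective. -/
theorem injective_finsupp [IsNoetherianRing A] [Module.Injective A Q] (ι : Type) :
    Module.Injective A (ι →₀ Q) := by
  refine Module.Baer.injective fun I g => ?_
  obtain ⟨s, hs⟩ : I.FG := IsNoetherian.noetherian I
  have hfin : ∃ t : Finset ι, ∀ x : I, (g x).support ⊆ t := by
    classical
    obtain ⟨s, hs⟩ : (⊤ : Submodule A I).FG := IsNoetherian.noetherian _
    refine ⟨s.biUnion fun x => (g x).support, fun x => ?_⟩
    have hx : x ∈ Submodule.span A (s : Set I) := hs ▸ Submodule.mem_top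
    induction hx using Submodule.span_induction with
    | mem x hx => exact Finset.subset_biUnion_of_mem (fun x => (g x).support) hx
    | zero => simp
    | add x y _ _ hx hy =>
      rw [map_add]
      exact Finsupp.support_add.trans (Finset.union_subset hx hy)
    | smul a x _ hx =>
      rw [map_smul]
      exact Finsupp.support_smul.trans hx
  obtain ⟨t, ht⟩ := hfin
  choose h hh using fun i : ι => exists_extension (A := A) (i := I.subtype)
    I.injective_subtype (Finsupp.lapply i ∘ₗ g)
  refine ⟨∑ i ∈ t, Finsupp.lsingle i ∘ₗ h i, fun x hx => ?_⟩
  have hh' : ∀ i, h i x = g ⟨x, hx⟩ i := fun i => LinearMap.congr_fun (hh i) ⟨x, hx⟩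
  simp only [LinearMap.sum_apply, LinearMap.comp_apply, Finsupp.lsingle_apply, hh']
  rw [← Finsupp.sum_of_support_subset (g ⟨x, hx⟩) (ht _) (fun i a => Finsupp.single i a)
    (by simp), Finsupp.sum_single]

theorem injective_of_projective [IsNoetherianRing A] [Module.Injective A A]
    (P : Type) [AddCommGroup P] [Module A P] [Module.Projective A P] : Module.Injective A P := by
  obtain ⟨s, hs⟩ := Module.projective_def.mp (inferInstance : Module.Projective A P)
  have : Module.Injective A (P →₀ A) := injective_finsupp P
  exact injective_of_retract s (Finsupp.linearCombination A id) (LinearMap.ext hs)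

/-- A linear map that factors through a projective module. -/
def IsNull (f : X →ₗ[A] Y) : Prop :=
  ∃ (P : Type) (_ : AddCommGroup P) (_ : Module A P) (_ : Module.Projective A P)
    (g : X →ₗ[A] P) (h : P →ₗ[A] Y), f = h ∘ₗ g

theorem IsNull.comp {f : X →ₗ[A] Y} (hf : IsNull f) (g : Y →ₗ[A] Z) : IsNull (g ∘ₗ f) := by
  obtain ⟨P, _, _, hP, u, v, rfl⟩ := hf
  exact ⟨P, _, _, hP, u, g ∘ₗ v, rfl⟩

theorem IsNull.precomp {f : Y →ₗ[A] Z} (hf : IsNull f) (g : X →ₗ[A] Y) : IsNull (f ∘ₗ g) := by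
  obtain ⟨P, _, _, hP, u, v, rfl⟩ := hf
  exact ⟨P, _, _, hP, u ∘ₗ g, v, rfl⟩

theorem IsNull.add {f g : X →ₗ[A] Y} (hf : IsNull f) (hg : IsNull g) : IsNull (f + g) := by
  obtain ⟨P, _, _, hP, u, v, rfl⟩ := hf
  obtain ⟨Q, _, _, hQ, u', v', rfl⟩ := hg
  exact ⟨P × Q, _, _, inferInstance, u.prod u', v.coprod v', by ext x; simp⟩

theorem IsNull.neg {f : X →ₗ[A] Y} (hf : IsNull f) : IsNull (-f) := by
  obtain ⟨P, _, _, hP, u, v, rfl⟩ := hf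
  exact ⟨P, _, _, hP, u, -v, by ext x; simp⟩

theorem isNull_of_projective_left [Module.Projective A X] (f : X →ₗ[A] Y) : IsNull f :=
  ⟨X, _, _, inferInstance, LinearMap.id, f, rfl⟩

theorem isNull_of_projective_right [Module.Projective A Y] (f : X →ₗ[A] Y) : IsNull f :=
  ⟨Y, _, _, inferInstance, f, LinearMap.id, rfl⟩

theorem isNull_zero : IsNull (0 : X →ₗ[A] Y) :=
  ⟨A, _, _, inferInstance, 0, 0, by simp⟩

theorem IsNull.sum {ι : Type} (s : Finset ι) {f : ι → X →ₗ[A] Y} (hf : ∀ i ∈ s, IsNull (f i)) :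
    IsNull (∑ i ∈ s, f i) := by
  classical
  induction s using Finset.induction_on with
  | empty => simpa using isNull_zero
  | insert i s hi ih =>
    rw [Finset.sum_insert hi]
    exact (hf i (Finset.mem_insert_self i s)).add
      (ih fun j hj => hf j (Finset.mem_insert_of_mem hj))

/-- Null maps lift along surjections. -/
theorem IsNull.exists_lift {f : X →ₗ[A] Y} (hf : IsNull f) {p : P →ₗ[A] Y}
    (hp : Function.Surjective p) : ∃ g : X →ₗ[A] P, p ∘ₗ g = f := by
  obtain ⟨Q, _, _, hQ, u, v, rfl⟩ := hf
  obtain ⟨w, hw⟩ := Module.projective_lifting_property p v hp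
  exact ⟨w ∘ₗ u, by rw [← LinearMap.comp_assoc, hw]⟩

/-- Null maps extend along injections to null maps. -/
theorem IsNull.exists_extension [IsNoetherianRing A] [Module.Injective A A]
    {f : X →ₗ[A] Y} (hf : IsNull f) {i : X →ₗ[A] Z} (hi : Function.Injective i) :
    ∃ g : Z →ₗ[A] Y, IsNull g ∧ g ∘ₗ i = f := by
  obtain ⟨Q, _, _, hQ, u, v, rfl⟩ := hf
  have := injective_of_projective (A := A) Q
  obtain ⟨w, hw⟩ := _root_.exists_extension hi u
  exact ⟨v ∘ₗ w, ⟨Q, _, _, hQ, w, v, rfl⟩, by rw [LinearMap.comp_assoc, hw]⟩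

variable (A X Y) in
/-- The stable Hom-group from `X` to `Y` vanishes. -/
def StZero : Prop := ∀ f : X →ₗ[A] Y, IsNull f

theorem StZero.of_retract_left (h : StZero A X Y) (i : Z →ₗ[A] X) (r : X →ₗ[A] Z)
    (hir : r ∘ₗ i = LinearMap.id) : StZero A Z Y := fun f => by
  have := (h (f ∘ₗ r)).precomp i
  rwa [LinearMap.comp_assoc, hir, LinearMap.comp_id] at this

theorem StZero.of_retract_right (h : StZero A X Y) (i : Z →ₗ[A] Y) (r : Y →ₗ[A] Z)
    (hir : r ∘ₗ i = LinearMap.id) : StZero A X Z := fun f => by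
  have := (h (i ∘ₗ f)).comp r
  rwa [← LinearMap.comp_assoc, hir, LinearMap.id_comp] at this

theorem StZero.congr_left (h : StZero A X Y) (e : X ≃ₗ[A] X') : StZero A X' Y :=
  h.of_retract_left e.symm.toLinearMap e.toLinearMap (by ext; simp)

theorem StZero.congr_right (h : StZero A X Y) (e : Y ≃ₗ[A] Y') : StZero A X Y' :=
  h.of_retract_right e.symm.toLinearMap e.toLinearMap (by ext; simp)

theorem StZero.pi_left {ι : Type} [Fintype ι] {V : ι → Type} [∀ i, AddCommGroup (V i)]
    [∀ i, Module A (V i)] (h : ∀ i, StZero A (V i) Y) : StZero A (∀ i, V i) Y := fun f => by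
  classical
  have : f = ∑ i, (f ∘ₗ LinearMap.single A V i) ∘ₗ LinearMap.proj i := by
    ext i x
    simp only [LinearMap.sum_apply, LinearMap.comp_apply, LinearMap.proj_apply,
      LinearMap.coe_single]
    rw [Finset.sum_eq_single i]
    · simp
    · intro j _ hj
      rw [Pi.single_eq_of_ne hj]; simp
    · simp
  rw [this]
  exact IsNull.sum _ fun i _ => (h i _).precomp _

theorem StZero.pi_right {ι : Type} [Fintype ι] {V : ι → Type} [∀ i, AddCommGroup (V i)]
    [∀ i, Module A (V i)] (h : ∀ i, StZero A X (V i)) : StZero A X (∀ i, V i) := fun f => by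
  classical
  have : f = ∑ i, LinearMap.single A V i ∘ₗ (LinearMap.proj i ∘ₗ f) := by
    ext x j
    simp [LinearMap.sum_apply, Finset.sum_apply]
  rw [this]
  exact IsNull.sum _ fun i _ => (h i _).comp _

theorem StZero.prod_right (h : StZero A X Y) (h' : StZero A X Z) : StZero A X (Y × Z) :=
  fun f => by
    have : f = LinearMap.inl A Y Z ∘ₗ (LinearMap.fst A Y Z ∘ₗ f) +
        LinearMap.inr A Y Z ∘ₗ (LinearMap.snd A Y Z ∘ₗ f) := by ext x <;> simp
    rw [this]
    exact ((h _).comp _).add ((h' _).comp _)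

/-- Short exact sequences of unbundled modules. -/
structure IsSES (f : X →ₗ[A] Y) (g : Y →ₗ[A] Z) : Prop where
  inj : Function.Injective f
  exact : Function.Exact f g
  surj : Function.Surjective g

theorem IsSES.comp_eq_zero {f : X →ₗ[A] Y} {g : Y →ₗ[A] Z} (h : IsSES f g) : g ∘ₗ f = 0 :=
  h.exact.linearMap_comp_eq_zero

theorem IsSES.exists_desc {f : X →ₗ[A] Y} {g : Y →ₗ[A] Z} (h : IsSES f g) (u : Y →ₗ[A] T)
    (hu : u ∘ₗ f = 0) : ∃ v : Z →ₗ[A] T, v ∘ₗ g = u := by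
  have hk : LinearMap.ker g ≤ LinearMap.ker u := by
    intro y hy
    obtain ⟨x, rfl⟩ := (h.exact y).mp hy
    exact LinearMap.congr_fun hu x
  refine ⟨(LinearMap.ker g).liftQ u hk ∘ₗ (g.quotKerEquivOfSurjective h.surj).symm, ?_⟩
  ext y
  have : (g.quotKerEquivOfSurjective h.surj).symm (g y) = (LinearMap.ker g).mkQ y := by
    rw [LinearEquiv.symm_apply_eq]; rfl
  simp [this]

theorem IsSES.exists_lift {f : X →ₗ[A] Y} {g : Y →ₗ[A] Z} (h : IsSES f g) (u : T →ₗ[A] Y)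
    (hu : g ∘ₗ u = 0) : ∃ v : T →ₗ[A] X, f ∘ₗ v = u := by
  have hr : ∀ t, u t ∈ LinearMap.range f := fun t =>
    (h.exact (u t)).mp (LinearMap.congr_fun hu t)
  refine ⟨(LinearEquiv.ofInjective f h.inj).symm ∘ₗ u.codRestrict _ hr, ?_⟩
  ext t
  have := LinearEquiv.apply_symm_apply (LinearEquiv.ofInjective f h.inj) ⟨u t, hr t⟩
  exact congrArg Subtype.val this

theorem IsSES.congr_left {f : X →ₗ[A] Y} {g : Y →ₗ[A] Z} (h : IsSES f g) (e : X' ≃ₗ[A] X) :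
    IsSES (f ∘ₗ e.toLinearMap) g where
  inj := h.inj.comp e.injective
  exact y := (h.exact y).trans ⟨fun ⟨x, hx⟩ => ⟨e.symm x, by simp [hx]⟩,
    fun ⟨x, hx⟩ => ⟨e x, hx⟩⟩
  surj := h.surj

theorem isSES_mkQ (N : Submodule A X) : IsSES N.subtype N.mkQ where
  inj := N.injective_subtype
  exact := LinearMap.exact_subtype_mkQ N
  surj := N.mkQ_surjective

theorem isSES_ker {g : Y →ₗ[A] Z} (hg : Function.Surjective g) :
    IsSES (LinearMap.ker g).subtype g where
  inj := (LinearMap.ker g).injective_subtype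
  exact := LinearMap.exact_subtype_ker_map g
  surj := hg

variable (A X Y) in
/-- `Y` is a cosyzygy of `X`, i.e. the cokernel of an embedding of `X` into a projective. -/
def IsStep : Prop :=
  ∃ (P : Type) (_ : AddCommGroup P) (_ : Module A P) (_ : Module.Projective A P)
    (f : X →ₗ[A] P) (g : P →ₗ[A] Y), IsSES f g

variable [IsNoetherianRing A] [Module.Injective A A]

theorem StZero.middle {i : X →ₗ[A] Y} {p : Y →ₗ[A] Z} (h : IsSES i p)
    (hX : StZero A X T) (hZ : StZero A Z T) : StZero A Y T := fun f => by
  obtain ⟨g, hg, hgi⟩ := (hX (f ∘ₗ i)).exists_extension h.inj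
  obtain ⟨v, hv⟩ := h.exists_desc (f - g) (by rw [LinearMap.sub_comp, hgi, sub_self])
  have := ((hZ v).precomp p).add hg
  rwa [hv, sub_add_cancel] at this

theorem StZero.right {i : X →ₗ[A] Y} {p : Y →ₗ[A] Z} (h : IsSES i p) (hT : IsStep A T T')
    (hX : StZero A X T) (hY : StZero A Y T') : StZero A Z T' := fun f => by
  obtain ⟨P, _, _, hP, a, b, hab⟩ := hT
  obtain ⟨u, hu⟩ := (hY (f ∘ₗ p)).exists_lift hab.surj
  obtain ⟨w, hw⟩ := hab.exists_lift (u ∘ₗ i) (by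
    rw [← LinearMap.comp_assoc, hu, LinearMap.comp_assoc, h.comp_eq_zero, LinearMap.comp_zero])
  obtain ⟨w', -, hw'⟩ := (hX w).exists_extension h.inj
  obtain ⟨v, hv⟩ := h.exists_desc (u - a ∘ₗ w') (by
    rw [LinearMap.sub_comp, LinearMap.comp_assoc, hw', hw, sub_self])
  refine ⟨P, _, _, hP, v, b, ?_⟩
  rw [← LinearMap.cancel_right h.surj, LinearMap.comp_assoc, hv, LinearMap.comp_sub, hu,
    ← LinearMap.comp_assoc, hab.comp_eq_zero, LinearMap.zero_comp, sub_zero]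

theorem StZero.left {i : X →ₗ[A] Y} {p : Y →ₗ[A] Z} (h : IsSES i p) (hT : IsStep A T T')
    (hY : StZero A Y T) (hZ : StZero A Z T') : StZero A X T := fun f => by
  obtain ⟨P, _, _, hP, a, b, hab⟩ := hT
  have := injective_of_projective (A := A) P
  obtain ⟨u, hu⟩ := exists_extension h.inj (a ∘ₗ f)
  obtain ⟨v, hv⟩ := h.exists_desc (b ∘ₗ u) (by
    rw [LinearMap.comp_assoc, hu, ← LinearMap.comp_assoc, hab.comp_eq_zero, LinearMap.zero_comp])
  obtain ⟨w, hw⟩ := (hZ v).exists_lift hab.surj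
  obtain ⟨g, hg⟩ := hab.exists_lift (u - w ∘ₗ p) (by
    rw [LinearMap.comp_sub, ← LinearMap.comp_assoc, hw, hv, sub_self])
  have hgf : g ∘ₗ i = f := by
    rw [← LinearMap.cancel_left hab.inj, ← LinearMap.comp_assoc, hg, LinearMap.sub_comp, hu,
      LinearMap.comp_assoc, h.comp_eq_zero, LinearMap.comp_zero, sub_zero]
  exact hgf ▸ (hY g).precomp i

theorem stZero_shift (hX : IsStep A X X') (hT : IsStep A T T') :
    StZero A X T ↔ StZero A X' T' := by
  obtain ⟨P, _, _, hP, a, b, hab⟩ := hX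
  exact ⟨fun h => h.right hab hT fun f => isNull_of_projective_left f,
    fun h => StZero.left hab hT (fun f => isNull_of_projective_left f) h⟩

end StableNull

/-! ## Exactness of the Nakayama functor and the embedding of modules into projective modules -/

section NakayamaExact

variable (k : Type) {A : Type} [Field k] [Ring A] [Algebra k A]
variable {X Y Z : Type} [AddCommGroup X] [Module A X] [AddCommGroup Y] [Module A Y]
  [AddCommGroup Z] [Module A Z]

/-- The Nakayama functor on morphisms. -/
def nuMap (f : X →ₗ[A] Y) : NuCarrier k A X →ₗ[A] NuCarrier k A Y where
  toFun φ := φ ∘ₗ LinearMap.lcomp k A f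
  map_add' _ _ := rfl
  map_smul' _ _ := rfl

theorem nuMap_apply (f : X →ₗ[A] Y) (φ : NuCarrier k A X) (h : Y →ₗ[A] A) :
    nuMap k f φ h = φ (h ∘ₗ f) := rfl

theorem nu_smul_apply (a : A) (φ : NuCarrier k A X) (h : X →ₗ[A] A) :
    (a • φ) h = φ (rmulHom k A X a h) := rfl

instance : IsScalarTower k A (NuCarrier k A X) where
  smul_assoc c a φ := by
    refine LinearMap.ext fun h => ?_
    rw [nu_smul_apply, LinearMap.smul_apply, nu_smul_apply, ← map_smul]
    congr 1
    ext x
    simp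

theorem isSES_lcomp [Module.Injective A A] {f : X →ₗ[A] Y} {g : Y →ₗ[A] Z} (h : IsSES f g) :
    IsSES (LinearMap.lcomp k A g) (LinearMap.lcomp k A f) where
  inj _ _ huv := (LinearMap.cancel_right h.surj).mp huv
  exact u := ⟨fun hu => h.exists_desc u hu, by
    rintro ⟨v, rfl⟩
    exact LinearMap.ext fun x => by simp [h.exact.apply_apply_eq_zero]⟩
  surj u := exists_extension h.inj u

theorem isSES_nuMap [Module.Injective A A] {f : X →ₗ[A] Y} {g : Y →ₗ[A] Z} (h : IsSES f g) :
    IsSES (nuMap k f) (nuMap k g) := by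
  have hk := isSES_lcomp k h
  refine ⟨fun φ ψ hφψ => ?_, fun φ => ⟨fun hφ => ?_, ?_⟩, fun φ => ?_⟩
  · exact (LinearMap.cancel_right hk.surj).mp hφψ
  · exact hk.exists_desc φ hφ
  · rintro ⟨ψ, rfl⟩
    refine LinearMap.ext fun u => ?_
    have : (u ∘ₗ g) ∘ₗ f = 0 := by
      rw [LinearMap.comp_assoc, h.comp_eq_zero, LinearMap.comp_zero]
    rw [nuMap_apply, nuMap_apply, this, map_zero]; rfl
  · exact LinearMap.dualMap_surjective_of_injective hk.inj φ

theorem subsingleton_nu_of_subsingleton [Subsingleton X] : Subsingleton (NuCarrier k A X) :=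
  ⟨fun φ ψ => LinearMap.ext fun f => by
    rw [show f = 0 from LinearMap.ext fun x => by
      rw [Subsingleton.elim x 0, map_zero, map_zero], map_zero, map_zero]⟩

variable [FiniteDimensional k A]

theorem finiteDimensional_linearMap_of_finite [Module k Y] [IsScalarTower k A Y] [Module.Finite A X]
    [Module.Finite A Y] :
    FiniteDimensional k (X →ₗ[A] Y) := by
  obtain ⟨n, p, hp⟩ := Module.Finite.exists_fin' A X
  have : Module.Finite k Y := Module.Finite.trans A Y
  let ev : (X →ₗ[A] Y) →ₗ[k] (Fin n → Y) :=
    { toFun := fun f i => f (p (Pi.single i 1))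
      map_add' := fun _ _ => rfl
      map_smul' := fun _ _ => rfl }
  refine Module.Finite.of_injective ev fun f g hfg => ?_
  rw [← LinearMap.cancel_right hp]
  ext i
  exact congrFun hfg i

instance nu_finite [Module.Finite A X] : Module.Finite A (NuCarrier k A X) := by
  have : FiniteDimensional k (X →ₗ[A] A) := finiteDimensional_linearMap_of_finite k
  exact Module.Finite.of_restrictScalars_finite k A _

theorem isSimple_nu_or_subsingleton [Module.Injective A A] [IsSimpleModule A X] :
    IsSimpleModule A (NuCarrier k A X) ∨ Subsingleton (NuCarrier k A X) := by
  rcases subsingleton_or_nontrivial (NuCarrier k A X) with h | h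
  · exact Or.inr h
  refine Or.inl ?_
  have : FiniteDimensional k (X →ₗ[A] A) := finiteDimensional_linearMap_of_finite k
  have hgen : ∀ f g : X →ₗ[A] A, f ≠ 0 → ∃ a, g = rmulHom k A X a f := by
    intro f g hf
    obtain ⟨u, hu⟩ := exists_extension (LinearMap.injective_of_ne_zero hf) g
    refine ⟨u 1, ?_⟩
    ext x
    rw [← hu]
    have := u.map_smul (f x) 1
    simpa using this
  refine isSimpleModule_iff_toSpanSingleton_surjective.mpr ⟨h, fun φ hφ ψ => ?_⟩
  by_contra hψ
  -- a functional on the dual that kills the orbit of `φ` but not `ψ`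
  have hψ' : ψ ∉ ((LinearMap.toSpanSingleton A _ φ).range.restrictScalars k) := by
    rintro ⟨a, ha⟩
    exact hψ ⟨a, ha⟩
  obtain ⟨θ, hθ, hle⟩ := Submodule.exists_le_ker_of_notMem hψ'
  obtain ⟨f, hf⟩ := (Module.evalEquiv k (X →ₗ[A] A)).surjective θ
  have hev : ∀ χ : NuCarrier k A X, θ χ = χ f := fun χ => by rw [← hf]; rfl
  have hf0 : f ≠ 0 := by
    rintro rfl
    exact hθ (by rw [hev, map_zero])
  apply hφ
  refine LinearMap.ext fun g => ?_
  obtain ⟨a, rfl⟩ := hgen f g hf0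
  have : θ (a • φ) = 0 := hle ⟨a, rfl⟩
  rwa [hev] at this

theorem length_nu_le [Module.Injective A A] (h : IsFiniteLength A X) :
    Module.length A (NuCarrier k A X) ≤ Module.length A X := by
  induction h with
  | of_subsingleton =>
    have := subsingleton_nu_of_subsingleton k (A := A) (X := ‹_›)
    rw [Module.length_eq_zero]
    exact zero_le
  | @of_simple_quotient M _ _ N hN _ ih =>
    have h := isSES_nuMap k (isSES_mkQ N)
    rw [Module.length_eq_add_of_exact _ _ h.inj h.surj h.exact,
      Module.length_eq_add_of_exact _ _ (isSES_mkQ N).inj (isSES_mkQ N).surj (isSES_mkQ N).exact]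
    refine add_le_add ih ?_
    rw [Module.length_eq_one A (M ⧸ N)]
    rcases isSimple_nu_or_subsingleton k (A := A) (X := M ⧸ N) with h | h
    · rw [Module.length_eq_one]
    · rw [Module.length_eq_zero]
      exact zero_le

/-- Every simple submodule of `ν X` is the image under `ν` of a simple module. -/
theorem exists_simple_of_embedding [Module.Injective A A] (h : IsFiniteLength A X)
    {T : Type} [AddCommGroup T] [Module A T] [IsSimpleModule A T] (j : T →ₗ[A] NuCarrier k A X)
    (hj : Function.Injective j) :
    ∃ (S : Type) (_ : AddCommGroup S) (_ : Module A S) (_ : IsSimpleModule A S),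
      Nonempty (NuCarrier k A S ≃ₗ[A] T) := by
  induction h with
  | of_subsingleton =>
    have := subsingleton_nu_of_subsingleton k (A := A) (X := ‹_›)
    have := IsSimpleModule.nontrivial A T
    exact absurd hj.subsingleton (not_subsingleton T)
  | @of_simple_quotient M _ _ N hN _ ih =>
    have h := isSES_nuMap k (isSES_mkQ N)
    rcases LinearMap.injective_or_eq_zero (nuMap k N.mkQ ∘ₗ j) with h' | h'
    · rcases isSimple_nu_or_subsingleton k (A := A) (X := M ⧸ N) with hs | hs
      · have := IsSimpleModule.nontrivial A T
        refine ⟨M ⧸ N, _, _, inferInstance,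
          ⟨(LinearEquiv.ofBijective (nuMap k N.mkQ ∘ₗ j) ?_).symm⟩⟩
        refine LinearMap.bijective_of_ne_zero ?_
        intro h0
        rw [h0] at h'
        exact not_subsingleton T ⟨fun a b => h' rfl⟩
      · have := IsSimpleModule.nontrivial A T
        exact absurd h'.subsingleton (not_subsingleton T)
    · obtain ⟨v, hv⟩ := h.exists_lift j h'
      refine ih v ?_
      rw [← hv] at hj
      exact Function.Injective.of_comp (f := nuMap k N.subtype) hj

end NakayamaExact

theorem isFiniteLength_of_finite (k : Type) {A : Type} [Field k] [Ring A] [Algebra k A] [FiniteDimensional k A]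
    (X : Type) [AddCommGroup X] [Module A X] [Module.Finite A X] :
    IsFiniteLength A X := by
  have := IsArtinianRing.of_finite k A
  exact isFiniteLength_iff_isNoetherian_isArtinian.mpr ⟨inferInstance, inferInstance⟩

section QuasiFrobenius

variable (k : Type) {A : Type} [Field k] [Ring A] [Algebra k A]

/-- Every simple module is a subquotient of the finitely generated module `U`. -/
def HasAllSimples (U : ModuleCat.{0} A) : Prop :=
  Module.Finite A U ∧ ∀ (T : Type) [AddCommGroup T] [Module A T] [IsSimpleModule A T],
    ∃ (V : Submodule A U) (q : V →ₗ[A] T), Function.Surjective q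

/-- The `k`-module structure on a module over a `k`-algebra. -/
abbrev restrictedModule (Y : Type) [AddCommGroup Y] [Module A Y] : Module k Y :=
  Module.compHom Y (algebraMap k A)

theorem restrictedModule_isScalarTower (Y : Type) [AddCommGroup Y] [Module A Y] :
    letI := restrictedModule k (A := A) Y
    IsScalarTower k A Y :=
  letI := restrictedModule k (A := A) Y
  ⟨fun c a t => by rw [Algebra.smul_def, mul_smul]; rfl⟩

/-- A `k`-linear functional on `Y` induces a map from `Y` to the dual of the regular
right module. -/
def toNuSelf {Y : Type} [AddCommGroup Y] [Module A Y] [Module k Y] [IsScalarTower k A Y]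
    (l : Y →ₗ[k] k) : Y →ₗ[A] NuCarrier k A A where
  toFun y :=
    { toFun := fun h => l (h 1 • y)
      map_add' := fun h h' => by simp [add_smul]
      map_smul' := fun c h => by simp }
  map_add' y y' := by ext; simp
  map_smul' a y := by
    refine LinearMap.ext fun h => ?_
    simp [nu_smul_apply, mul_smul]

theorem toNuSelf_apply {Y : Type} [AddCommGroup Y] [Module A Y] [Module k Y]
    [IsScalarTower k A Y] (l : Y →ₗ[k] k) (y : Y) (h : A →ₗ[A] A) :
    toNuSelf k l y h = l (h 1 • y) := rfl

/-- Every simple module embeds into the dual of the regular right module. -/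
theorem exists_embedding_nu_self (T : Type) [AddCommGroup T] [Module A T] [IsSimpleModule A T] :
    ∃ j : T →ₗ[A] NuCarrier k A A, Function.Injective j := by
  let _ : Module k T := restrictedModule k (A := A) T
  have : IsScalarTower k A T := restrictedModule_isScalarTower k T
  have := IsSimpleModule.nontrivial A T
  obtain ⟨t, ht⟩ := exists_ne (0 : T)
  obtain ⟨l, hl⟩ := Module.Projective.exists_dual_ne_zero k ht
  refine ⟨toNuSelf k l, LinearMap.injective_of_ne_zero fun h => hl ?_⟩
  have := LinearMap.congr_fun (LinearMap.congr_fun h t) LinearMap.id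
  simpa [toNuSelf_apply] using this

variable [FiniteDimensional k A] [Module.Injective A A]

theorem HasAllSimples.nu {U : ModuleCat.{0} A} (h : HasAllSimples U) :
    HasAllSimples (NuMod k A U) := by
  have := h.1
  refine ⟨inferInstanceAs (Module.Finite A (NuCarrier k A U)), fun T _ _ _ => ?_⟩
  obtain ⟨j, hj⟩ := exists_embedding_nu_self k (A := A) T
  obtain ⟨S, _, _, _, ⟨e⟩⟩ :=
    exists_simple_of_embedding k (isFiniteLength_of_finite k A) j hj
  obtain ⟨V, q, hq⟩ := h.2 S
  have hV := isSES_nuMap k (isSES_mkQ V)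
  have hqs := isSES_nuMap k (isSES_ker hq)
  refine ⟨LinearMap.range (nuMap k V.subtype), e.toLinearMap ∘ₗ nuMap k q ∘ₗ
    (LinearEquiv.ofInjective (nuMap k V.subtype) hV.inj).symm.toLinearMap, ?_⟩
  exact e.surjective.comp (hqs.surj.comp (LinearEquiv.surjective _))

/-- A finite-dimensional left self-injective algebra is a cogenerator for simple modules. -/
theorem nontrivial_dual_of_simple (S : Type) [AddCommGroup S] [Module A S] [IsSimpleModule A S] :
    Nontrivial (NuCarrier k A S) := by
  by_contra hS
  rw [not_nontrivial_iff_subsingleton] at hS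
  have hA : HasAllSimples (ModuleCat.of A A) := by
    refine ⟨inferInstanceAs (Module.Finite A A), fun T _ _ _ => ?_⟩
    have := IsSimpleModule.nontrivial A T
    obtain ⟨t, ht⟩ := exists_ne (0 : T)
    exact ⟨⊤, LinearMap.toSpanSingleton A T t ∘ₗ Submodule.subtype _,
      (IsSimpleModule.toSpanSingleton_surjective A ht).comp
        (fun a => ⟨⟨a, trivial⟩, rfl⟩)⟩
  obtain ⟨U, hU, hmin⟩ := (InvImage.wf (fun U : ModuleCat.{0} A => Module.length A U)
    wellFounded_lt).has_min {U | HasAllSimples U} ⟨_, hA⟩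
  have := hU.1
  refine hmin _ (HasAllSimples.nu k hU) ?_
  obtain ⟨V, q, hq⟩ := hU.2 S
  change Module.length A (NuCarrier k A U) < Module.length A U
  have hV := isSES_nuMap k (isSES_mkQ V)
  have hqs := isSES_nuMap k (isSES_ker hq)
  have hfin : ∀ W : Submodule A U, IsFiniteLength A W ∧ IsFiniteLength A (U ⧸ W) := fun W =>
    let := IsNoetherianRing.of_finite k A
    ⟨isFiniteLength_of_finite k W, isFiniteLength_of_finite k _⟩
  rw [Module.length_eq_add_of_exact _ _ hV.inj hV.surj hV.exact,
    Module.length_eq_add_of_exact _ _ hqs.inj hqs.surj hqs.exact,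
    Module.length_eq_zero (R := A) (M := NuCarrier k A S),
    Module.length_eq_add_of_exact _ _ (isSES_mkQ V).inj (isSES_mkQ V).surj (isSES_mkQ V).exact,
    Module.length_eq_add_of_exact _ _ (isSES_ker hq).inj (isSES_ker hq).surj (isSES_ker hq).exact,
    Module.length_eq_one A S, add_zero]
  have hker : IsFiniteLength A (LinearMap.ker q) :=
    let := IsNoetherianRing.of_finite k A
    isFiniteLength_of_finite k _
  refine ENat.add_lt_add_of_lt_of_le ?_ ?_ (length_nu_le k (hfin V).2)
  · exact ne_top_of_le_ne_top (Module.length_ne_top_iff.mpr (hfin V).2)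
      (length_nu_le k (hfin V).2)
  · exact (length_nu_le k hker).trans_lt
      (ENat.lt_add_one_iff (Module.length_ne_top_iff.mpr hker) |>.mpr le_rfl)

end QuasiFrobenius

/-- Finitely generated modules embed into finitely generated free modules. -/
theorem exists_embedding_free (k : Type) {A : Type} [Field k] [Ring A] [Algebra k A] [FiniteDimensional k A]
    [Module.Injective A A] (X : Type) [AddCommGroup X] [Module A X] [Module.Finite A X] :
    ∃ (m : ℕ) (i : X →ₗ[A] (Fin m → A)), Function.Injective i := by
  have : FiniteDimensional k (X →ₗ[A] A) := finiteDimensional_linearMap_of_finite k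
  let b := Module.finBasis k (X →ₗ[A] A)
  refine ⟨_, LinearMap.pi fun j => b j, (injective_iff_map_eq_zero _).mpr fun x hx => ?_⟩
  have hall : ∀ f : X →ₗ[A] A, f x = 0 := by
    intro f
    rw [← b.sum_repr f, LinearMap.sum_apply]
    refine Finset.sum_eq_zero fun j _ => ?_
    rw [LinearMap.smul_apply, show b j x = 0 from congrFun hx j, smul_zero]
  by_contra hx0
  let g := LinearMap.toSpanSingleton A X x
  have hg : LinearMap.ker g ≠ ⊤ := fun h => hx0 (by
    have : (1 : A) ∈ LinearMap.ker g := h ▸ Submodule.mem_top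
    simpa [g] using this)
  obtain ⟨m, hm, hgm⟩ := Ideal.exists_le_maximal (LinearMap.ker g) hg
  have : IsSimpleModule A (A ⧸ m) := isSimpleModule_iff_isCoatom.mpr hm.out
  obtain ⟨f, hf⟩ : ∃ f : (A ⧸ m) →ₗ[A] A, f ≠ 0 := by
    by_contra! hz
    have := nontrivial_dual_of_simple k (A := A) (A ⧸ m)
    refine not_subsingleton (NuCarrier k A (A ⧸ m)) ⟨fun φ ψ => LinearMap.ext fun f => ?_⟩
    rw [hz f, map_zero, map_zero]
  have h1 : f (m.mkQ 1) ≠ 0 := fun h => hf (by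
    ext
    simpa using h)
  have hs := isSES_ker g.surjective_rangeRestrict
  have hker : LinearMap.ker g.rangeRestrict = LinearMap.ker g := g.ker_rangeRestrict
  obtain ⟨u, hu⟩ := hs.exists_desc (f ∘ₗ m.mkQ) (by
    ext ⟨a, ha⟩
    rw [hker] at ha
    have : m.mkQ a = 0 := (Submodule.Quotient.mk_eq_zero m).mpr (hgm ha)
    simp only [LinearMap.comp_apply, Submodule.subtype_apply, this, map_zero,
      LinearMap.zero_apply])
  obtain ⟨v, hv⟩ := exists_extension (LinearMap.range g).injective_subtype u
  apply h1
  have e1 := LinearMap.congr_fun hu 1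
  have e2 := LinearMap.congr_fun hv (g.rangeRestrict 1)
  simp only [LinearMap.comp_apply] at e1 e2
  rw [← e1, ← e2]
  have : (LinearMap.range g).subtype (g.rangeRestrict 1) = x := by simp [g]
  rw [this, hall v]

theorem projective_of_injective_of_finite (k : Type) {A : Type} [Field k] [Ring A] [Algebra k A] [FiniteDimensional k A]
    [Module.Injective A A] (X : Type) [AddCommGroup X] [Module A X]
    [Module.Finite A X] [Module.Injective A X] : Module.Projective A X := by
  obtain ⟨m, i, hi⟩ := exists_embedding_free k (A := A) X
  obtain ⟨r, hr⟩ := exists_extension hi LinearMap.id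
  exact Module.Projective.of_split i r hr

/-- Every module over a finite-dimensional self-injective algebra embeds into a free module. -/
theorem exists_embedding_projective (k : Type) {A : Type} [Field k] [Ring A] [Algebra k A] [FiniteDimensional k A]
    [Module.Injective A A] (Y : Type) [AddCommGroup Y] [Module A Y] :
    ∃ (ι : Type) (i : Y →ₗ[A] (ι →₀ A)), Function.Injective i := by
  let _ : Module k Y := restrictedModule k (A := A) Y
  have : IsScalarTower k A Y := restrictedModule_isScalarTower k Y
  let b := Module.Basis.ofVectorSpace k Y
  let c := Module.finBasis k A
  obtain ⟨m, i, hi⟩ := exists_embedding_free k (A := A) (NuCarrier k A A)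
  classical
  have hsupp : ∀ (y : Y) j, toNuSelf k (A := A) (b.coord j) y ≠ 0 →
      j ∈ Finset.univ.biUnion fun l => (b.repr (c l • y)).support := by
    intro y j hj
    by_contra hn
    simp only [Finset.mem_biUnion, Finset.mem_univ, true_and, not_exists,
      Finsupp.mem_support_iff, not_not] at hn
    refine hj (LinearMap.ext fun h => ?_)
    rw [toNuSelf_apply, ← c.sum_repr (h 1), Finset.sum_smul, map_sum]
    refine Finset.sum_eq_zero fun l _ => ?_
    rw [smul_assoc, map_smul, Module.Basis.coord_apply, hn l, smul_zero]
  let u : Y →ₗ[A] (_ →₀ NuCarrier k A A) :=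
    { toFun := fun y => Finsupp.onFinset _ (fun j => toNuSelf k (A := A) (b.coord j) y) (hsupp y)
      map_add' := fun y y' => by ext1 j; simp
      map_smul' := fun a y => by ext1 j; simp }
  have hu : Function.Injective u := by
    refine (injective_iff_map_eq_zero u).mpr fun y hy => ?_
    refine b.repr.injective (Finsupp.ext fun j => ?_)
    have h1 : toNuSelf k (A := A) (b.coord j) y = 0 := DFunLike.congr_fun hy j
    have := LinearMap.congr_fun h1 LinearMap.id
    simpa [toNuSelf_apply] using this
  let w : NuCarrier k A A →ₗ[A] (Fin m →₀ A) :=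
    (Finsupp.linearEquivFunOnFinite A A (Fin m)).symm.toLinearMap ∘ₗ i
  have hw : Function.Injective w :=
    (Finsupp.linearEquivFunOnFinite A A (Fin m)).symm.injective.comp hi
  refine ⟨_, (Finsupp.curryLinearEquiv A).symm.toLinearMap ∘ₗ Finsupp.mapRange.linearMap w ∘ₗ u,
    ?_⟩
  exact (Finsupp.curryLinearEquiv A).symm.injective.comp
    ((Finsupp.mapRange_injective _ (map_zero w) hw).comp hu)

/-- Every module has a cosyzygy. -/
theorem exists_isStep_right (k : Type) {A : Type} [Field k] [Ring A] [Algebra k A] [FiniteDimensional k A]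
    [Module.Injective A A] (Y : Type) [AddCommGroup Y] [Module A Y] :
    ∃ Z : ModuleCat.{0} A, IsStep A Y Z := by
  obtain ⟨ι, i, hi⟩ := exists_embedding_projective k (A := A) Y
  exact ⟨ModuleCat.of A ((ι →₀ A) ⧸ LinearMap.range i), _, _, _, inferInstance, i,
    (LinearMap.range i).mkQ, hi, LinearMap.exact_map_mkQ_range i, Submodule.mkQ_surjective _⟩

/-- Every module has a syzygy, which is finitely generated if the module is. -/
theorem exists_isStep_left {A : Type} [Ring A] [IsNoetherianRing A] (Y : Type) [AddCommGroup Y]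
    [Module A Y] : ∃ Z : ModuleCat.{0} A, IsStep A Z Y ∧ (Module.Finite A Y → Module.Finite A Z) := by
  by_cases hY : Module.Finite A Y
  · obtain ⟨n, p, hp⟩ := Module.Finite.exists_fin' A Y
    exact ⟨ModuleCat.of A (LinearMap.ker p), ⟨_, _, _, inferInstance, _, p, isSES_ker hp⟩,
      fun _ => inferInstanceAs (Module.Finite A (LinearMap.ker p))⟩
  · have hp : Function.Surjective (Finsupp.linearCombination A (id : Y → Y)) :=
      Finsupp.linearCombination_id_surjective A Y
    exact ⟨ModuleCat.of A (LinearMap.ker (Finsupp.linearCombination A (id : Y → Y))),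
      ⟨_, _, _, inferInstance, _, _, isSES_ker hp⟩, fun h => absurd h hY⟩

section Duality

theorem exists_dual_basis {A : Type} [Ring A] (P : Type) [AddCommGroup P] [Module A P]
    [Module.Finite A P] [Module.Projective A P] :
    ∃ (n : ℕ) (e : Fin n → P) (c : Fin n → P →ₗ[A] A), ∀ x, x = ∑ j, c j x • e j := by
  obtain ⟨n, f, g, -, -, hfg⟩ := Module.Finite.exists_comp_eq_id_of_projective A P
  refine ⟨n, fun j => f (Pi.single j 1), fun j => LinearMap.proj j ∘ₗ g, fun x => ?_⟩
  conv_lhs => rw [← LinearMap.id_apply (R := A) x, ← hfg, LinearMap.comp_apply,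
    LinearMap.pi_apply_eq_sum_univ f (g x)]
  refine Finset.sum_congr rfl fun j _ => ?_
  congr 2
  ext l
  simp [Pi.single_apply, eq_comm]

variable (k : Type) {A : Type} [Field k] [Ring A] [Algebra k A]

/-- The Nakayama functor sends finitely generated projectives to injectives. -/
theorem nu_injective (P : Type) [AddCommGroup P] [Module A P] [Module.Finite A P]
    [Module.Projective A P] : Module.Injective A (NuCarrier k A P) where
  out X Y _ _ _ _ i hi h := by
    obtain ⟨n, e, c, hec⟩ := exists_dual_basis (A := A) P
    let _ : Module k X := restrictedModule k (A := A) X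
    have : IsScalarTower k A X := restrictedModule_isScalarTower k X
    let _ : Module k Y := restrictedModule k (A := A) Y
    have : IsScalarTower k A Y := restrictedModule_isScalarTower k Y
    have hext : ∀ j, ∃ l : Y →ₗ[k] k, l ∘ₗ i.restrictScalars k =
        LinearMap.applyₗ (c j) ∘ₗ h.restrictScalars k := fun j => by
      obtain ⟨r, hr⟩ := (i.restrictScalars k).exists_leftInverse_of_injective
        (LinearMap.ker_eq_bot.mpr hi)
      exact ⟨(LinearMap.applyₗ (c j) ∘ₗ h.restrictScalars k) ∘ₗ r, by
        rw [LinearMap.comp_assoc, hr, LinearMap.comp_id]⟩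
    choose l hl using hext
    let h' : Y →ₗ[A] NuCarrier k A P :=
      { toFun := fun y =>
          { toFun := fun f => ∑ j, l j (f (e j) • y)
            map_add' := fun f g => by simp [add_smul, Finset.sum_add_distrib]
            map_smul' := fun t f => by simp [Finset.mul_sum] }
        map_add' := fun y y' => by ext f; simp [Finset.sum_add_distrib]
        map_smul' := fun a y => by
          refine LinearMap.ext fun f => ?_
          simp [nu_smul_apply, mul_smul] }
    refine ⟨h', fun x => LinearMap.ext fun f => ?_⟩
    have hf : f = ∑ j, rmulHom k A P (f (e j)) (c j) := by
      ext y
      conv_lhs => rw [hec y]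
      simp
    change ∑ j, l j (f (e j) • i x) = h x f
    conv_rhs => rw [hf]
    rw [map_sum]
    refine Finset.sum_congr rfl fun j _ => ?_
    rw [← nu_smul_apply, ← map_smul, ← map_smul]
    exact LinearMap.congr_fun (hl j) (f (e j) • x)

/-- A form of Auslander–Reiten duality. -/
theorem stZero_of_lift_nu [Module.Injective A A] {N P Q L X : Type} [AddCommGroup N] [Module A N]
    [AddCommGroup P] [Module A P] [AddCommGroup Q] [Module A Q] [AddCommGroup L] [Module A L]
    [AddCommGroup X] [Module A X] [Module.Finite A P] [Module.Projective A P] [Module.Finite A Q]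
    [Module.Projective A Q] (ρ : P →ₗ[A] N) {ι : N →ₗ[A] Q} {π : Q →ₗ[A] L} (h : IsSES ι π)
    (hlift : ∀ u : X →ₗ[A] NuCarrier k A N, ∃ v : X →ₗ[A] NuCarrier k A P, nuMap k ρ ∘ₗ v = u) :
    StZero A L X := fun g => by
  by_contra hg
  let _ : Module k X := restrictedModule k (A := A) X
  have : IsScalarTower k A X := restrictedModule_isScalarTower k X
  let V : Submodule k (L →ₗ[A] X) := Submodule.span k
    (Set.range fun lx : (L →ₗ[A] A) × X => LinearMap.toSpanSingleton A X lx.2 ∘ₗ lx.1)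
  have hV : ∀ f ∈ V, IsNull f := fun f hf => by
    induction hf using Submodule.span_induction with
    | mem f hf =>
      obtain ⟨⟨l, x⟩, rfl⟩ := hf
      exact ⟨A, _, _, inferInstance, _, _, rfl⟩
    | zero => exact isNull_zero
    | add f f' _ _ hf hf' => exact hf.add hf'
    | smul c f _ hf =>
      obtain ⟨P, _, _, hP, u, v, rfl⟩ := hf
      exact ⟨P, _, _, hP, u, c • v, by ext; simp⟩
  have hgV : LinearMap.lcomp k X π g ∉ V.map (LinearMap.lcomp k X π) := by
    rintro ⟨f, hf, hfg⟩
    have : f = g := (LinearMap.cancel_right h.surj).mp hfg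
    exact hg (this ▸ hV f hf)
  obtain ⟨θ, hθg, hθ⟩ := Submodule.exists_le_ker_of_notMem hgV
  let Θ : X →ₗ[A] NuCarrier k A Q :=
    { toFun := fun x =>
        { toFun := fun q => θ (LinearMap.toSpanSingleton A X x ∘ₗ q)
          map_add' := fun q q' => by
            rw [← map_add]; congr 1; ext; simp [add_smul]
          map_smul' := fun c q => by
            rw [← map_smul]; congr 1; ext; simp }
      map_add' := fun x y => by
        refine LinearMap.ext fun q => ?_
        change θ _ = θ _ + θ _
        rw [← map_add]; congr 1; ext; simp
      map_smul' := fun a x => by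
        refine LinearMap.ext fun q => ?_
        change θ _ = θ _
        congr 1; ext; simp [mul_smul] }
  have hΘ : ∀ x q, Θ x q = θ (LinearMap.toSpanSingleton A X x ∘ₗ q) := fun _ _ => rfl
  obtain ⟨Θ', hΘ'⟩ := (isSES_nuMap k h).exists_lift Θ (by
    refine LinearMap.ext fun x => LinearMap.ext fun l => ?_
    change Θ x (l ∘ₗ π) = 0
    rw [hΘ]
    exact hθ ⟨LinearMap.toSpanSingleton A X x ∘ₗ l, Submodule.subset_span ⟨(l, x), rfl⟩, rfl⟩)
  obtain ⟨Ψ, hΨ⟩ := hlift Θ'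
  have hΘΨ : ∀ x q, Θ x q = Ψ x (q ∘ₗ ι ∘ₗ ρ) := fun x q => by
    rw [← hΘ', ← hΨ]; rfl
  obtain ⟨n, e, c, hec⟩ := exists_dual_basis (A := A) P
  obtain ⟨m, d, b, hdb⟩ := exists_dual_basis (A := A) Q
  apply hθg
  have h1 : LinearMap.lcomp k X π g =
      ∑ j, LinearMap.toSpanSingleton A X (g (π (d j))) ∘ₗ b j := by
    ext y
    change g (π y) = _
    conv_lhs => rw [hdb y]
    simp
  have h2 : ∀ q : Q →ₗ[A] A, q ∘ₗ ι ∘ₗ ρ =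
      ∑ j, rmulHom k A P (q (ι (ρ (e j)))) (c j) := fun q => by
    ext y
    conv_lhs => rw [hec y]
    simp
  rw [h1, map_sum]
  simp only [← hΘ, hΘΨ, h2, map_sum, ← nu_smul_apply, ← map_smul]
  rw [Finset.sum_comm]
  simp only [← LinearMap.sum_apply, ← map_sum]
  refine Finset.sum_eq_zero fun j _ => ?_
  simp only [← hdb]
  rw [show π (ι (ρ (e j))) = 0 from LinearMap.congr_fun h.comp_eq_zero _]
  simp

end Duality

section CompleteResolutions

variable {A : Type} [Ring A]

/-- A choice of syzygy of a module. -/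
noncomputable def syzygy [IsNoetherianRing A] (Y : ModuleCat.{0} A) : ModuleCat.{0} A :=
  (exists_isStep_left (A := A) Y).choose

theorem isStep_syzygy [IsNoetherianRing A] (Y : ModuleCat.{0} A) : IsStep A (syzygy Y) Y :=
  (exists_isStep_left (A := A) Y).choose_spec.1

theorem finite_syzygy [IsNoetherianRing A] (Y : ModuleCat.{0} A) [hY : Module.Finite A Y] :
    Module.Finite A (syzygy Y) :=
  (exists_isStep_left (A := A) Y).choose_spec.2 hY

/-- The extension of a sequence of cosyzygies to the left by iterated syzygies. -/
noncomputable def extendLeft [IsNoetherianRing A] (R : ℕ → ModuleCat.{0} A) :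
    ℤ → ModuleCat.{0} A
  | Int.ofNat n => R n
  | Int.negSucc n => syzygy^[n + 1] (R 0)

theorem isStep_extendLeft [IsNoetherianRing A] {R : ℕ → ModuleCat.{0} A}
    (hR : ∀ n, IsStep A (R n) (R (n + 1))) :
    ∀ i, IsStep A (extendLeft R i) (extendLeft R (i + 1))
  | Int.ofNat n => hR n
  | Int.negSucc 0 => isStep_syzygy (R 0)
  | Int.negSucc (n + 1) => by
    rw [show Int.negSucc (n + 1) + 1 = Int.negSucc n by omega]
    change IsStep A (syzygy^[n + 1 + 1] (R 0)) (syzygy^[n + 1] (R 0))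
    rw [Function.iterate_succ_apply']
    exact isStep_syzygy _

theorem finite_extendLeft [IsNoetherianRing A] {R : ℕ → ModuleCat.{0} A}
    (hR : ∀ n, Module.Finite A (R n)) : ∀ i, Module.Finite A (extendLeft R i)
  | Int.ofNat n => hR n
  | Int.negSucc n => by
    change Module.Finite A (syzygy^[n + 1] (R 0))
    generalize n + 1 = m
    induction m with
    | zero => exact hR 0
    | succ m ih =>
      rw [Function.iterate_succ_apply']
      exact finite_syzygy _

theorem stZero_shift_int [IsNoetherianRing A] [Module.Injective A A] {D T : ℤ → ModuleCat.{0} A}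
    (hD : ∀ i, IsStep A (D i) (D (i + 1))) (hT : ∀ i, IsStep A (T i) (T (i + 1))) (i j n : ℤ) :
    StZero A (D i) (T j) ↔ StZero A (D (i + n)) (T (j + n)) := by
  induction n using Int.induction_on with
  | zero => rw [add_zero, add_zero]
  | succ n ih =>
    rw [ih, ← add_assoc, ← add_assoc]
    exact stZero_shift (hD _) (hT _)
  | pred n ih =>
    rw [ih]
    have := stZero_shift (hD (i + (-n - 1))) (hT (j + (-n - 1)))
    rw [this, show i + (-(n : ℤ) - 1) + 1 = i + -n by ring,
      show j + (-(n : ℤ) - 1) + 1 = j + -n by ring]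

/-- A sequence of iterated cosyzygies of a module. -/
noncomputable def cosyzygies (k : Type) {A : Type} [Field k] [Ring A] [Algebra k A]
    [FiniteDimensional k A] [Module.Injective A A] (Y : ModuleCat.{0} A) :
    ℕ → ModuleCat.{0} A
  | 0 => Y
  | n + 1 => (exists_isStep_right k (A := A) (cosyzygies k Y n)).choose

theorem isStep_cosyzygies (k : Type) {A : Type} [Field k] [Ring A] [Algebra k A]
    [FiniteDimensional k A] [Module.Injective A A] (Y : ModuleCat.{0} A) (n : ℕ) :
    IsStep A (cosyzygies k Y n) (cosyzygies k Y (n + 1)) :=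
  (exists_isStep_right k (A := A) (cosyzygies k Y n)).choose_spec

end CompleteResolutions

section Ext

variable {A : Type} [Ring A]

/-- The terms of the projective resolution computing `Ext` from which vanishing of stable
homomorphisms can be read off. -/
theorem exists_syzygies_of_extZero {n : ℕ} {X Y : ModuleCat.{0} A} (h : extZero A (n + 1) X Y) :
    ∃ Z : ℕ → ModuleCat.{0} A, Z 0 = X ∧ (∀ i, IsStep A (Z (i + 1)) (Z i)) ∧
      StZero A (Z (n + 1)) Y := by
  let P := projectiveResolution X
  let Z : ℕ → ModuleCat.{0} A := fun i => Nat.casesOn i X fun i =>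
    ModuleCat.of A (LinearMap.range (P.complex.d (i + 1) i).hom)
  have hproj : ∀ i, Module.Projective A (P.complex.X i) := fun i =>
    (IsProjective.iff_projective (R := A) _).mpr (P.projective i)
  refine ⟨Z, rfl, ?_, ?_⟩
  · rintro (_ | i)
    · change IsStep A (LinearMap.range (P.complex.d 1 0).hom) X
      refine ⟨P.complex.X 0, _, _, hproj 0, Submodule.subtype _, (P.π.f 0).hom,
        Submodule.injective_subtype _, ?_, (ModuleCat.epi_iff_surjective _).mp inferInstance⟩
      have := (ShortComplex.ShortExact.moduleCat_exact_iff_function_exact _).mp P.exact₀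
      intro y
      exact (this y).trans ⟨fun ⟨x, hx⟩ => ⟨⟨_, x, rfl⟩, hx⟩, fun ⟨⟨_, x, rfl⟩, hx⟩ => ⟨x, hx⟩⟩
    · change IsStep A (LinearMap.range (P.complex.d (i + 2) (i + 1)).hom)
        (LinearMap.range (P.complex.d (i + 1) i).hom)
      refine ⟨P.complex.X (i + 1), _, _, hproj _, Submodule.subtype _,
        (P.complex.d (i + 1) i).hom.rangeRestrict, Submodule.injective_subtype _, ?_,
        LinearMap.surjective_rangeRestrict _⟩
      have := (ShortComplex.ShortExact.moduleCat_exact_iff_function_exact _).mp (P.exact_succ i)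
      intro y
      rw [← LinearMap.mem_ker, LinearMap.ker_rangeRestrict]
      exact (this y).trans ⟨fun ⟨x, hx⟩ => ⟨⟨_, x, rfl⟩, hx⟩, fun ⟨⟨_, x, rfl⟩, hx⟩ => ⟨x, hx⟩⟩
  · intro f
    have hz : Limits.IsZero ((P.complex.linearYonedaObj ℤ Y).homology (n + 1)) :=
      Limits.IsZero.of_iso (ModuleCat.isZero_of_iff_subsingleton.mpr h) (P.isoExt (n + 1) Y).symm
    rw [← HomologicalComplex.exactAt_iff_isZero_homology,
      HomologicalComplex.exactAt_iff' _ n (n + 1) (n + 2) (by simp) (by simp),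
      ShortComplex.moduleCat_exact_iff] at hz
    obtain ⟨g, hg⟩ := hz (ModuleCat.ofHom (f ∘ₗ (P.complex.d (n + 1) n).hom.rangeRestrict)) (by
      change P.complex.d (n + 2) (n + 1) ≫ _ = 0
      ext x
      have : (P.complex.d (n + 1) n).hom.rangeRestrict ((P.complex.d (n + 2) (n + 1)).hom x) = 0 :=
        Subtype.ext (LinearMap.congr_fun
          (congrArg ModuleCat.Hom.hom (P.complex.d_comp_d (n + 2) (n + 1) n)) x)
      simp [this])
    refine ⟨P.complex.X n, _, _, hproj n, Submodule.subtype _, g.hom, ?_⟩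
    refine (LinearMap.cancel_right (LinearMap.surjective_rangeRestrict _)).mp ?_
    exact (congrArg ModuleCat.Hom.hom hg).symm

theorem stZero_of_extZero [IsNoetherianRing A] [Module.Injective A A] {n : ℕ} (hn : 1 ≤ n)
    {X : ModuleCat.{0} A} {W : ℕ → ModuleCat.{0} A} (hW : ∀ i, IsStep A (W i) (W (i + 1)))
    (h : extZero A n X (W 0)) : StZero A X (W n) := by
  obtain ⟨n, rfl⟩ := Nat.exists_eq_add_of_le' hn
  obtain ⟨Z, rfl, hZ, hn⟩ := exists_syzygies_of_extZero h
  have key : ∀ i ≤ n + 1, StZero A (Z (n + 1 - i)) (W i) := fun i => by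
    induction i with
    | zero => exact fun _ => hn
    | succ i ih =>
      intro hi
      refine (stZero_shift (hZ (n + 1 - (i + 1))) (hW i)).mp ?_
      rw [show n + 1 - (i + 1) + 1 = n + 1 - i by omega]
      exact ih (by omega)
  have := key (n + 1) le_rfl
  rwa [Nat.sub_self] at this

end Ext

section Cosyzygies

/-- Injective envelopes of finitely generated modules are finitely generated projective. -/
theorem IsInjEnvelope.finite_projective (k : Type) {A : Type} [Field k] [Ring A] [Algebra k A]
    [FiniteDimensional k A] [Module.Injective A A] {N I : ModuleCat.{0} A} {ι : N ⟶ I}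
    (h : IsInjEnvelope A ι) [Module.Finite A N] : Module.Finite A I ∧ Module.Projective A I := by
  obtain ⟨hI, hι, hess⟩ := h
  have := IsNoetherianRing.of_finite k A
  obtain ⟨m, i, hi⟩ := exists_embedding_free k (A := A) N
  have : Module.Injective A (Fin m → A) := injective_of_projective (A := A) _
  obtain ⟨u, hu⟩ := exists_extension (A := A) (i := ι.hom) hι i
  have hui : Function.Injective u := by
    rw [← LinearMap.ker_eq_bot]
    refine hess _ ((Submodule.eq_bot_iff _).mpr ?_)
    rintro _ ⟨hx, y, rfl⟩
    have : i y = 0 := (LinearMap.congr_fun hu y).symm.trans hx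
    rw [hi (this.trans (map_zero i).symm), map_zero]
  have hfin : Module.Finite A I := Module.Finite.of_injective u hui
  exact ⟨hfin, projective_of_injective_of_finite k I⟩

/-- Consecutive cosyzygies are related by short exact sequences with finitely generated
projective middle term. -/
theorem IsMinInjCoresolution.exists_isSES (k : Type) {A : Type} [Field k] [Ring A] [Algebra k A]
    [FiniteDimensional k A] [Module.Injective A A] {M : ModuleCat.{0} A} [Module.Finite A M]
    {C : ℕ → ModuleCat.{0} A} (hC : IsMinInjCoresolution A M C) (n : ℕ) :
    Module.Finite A (C n) ∧ ∃ (I : ModuleCat.{0} A) (f : C n →ₗ[A] I) (g : I →ₗ[A] C (n + 1)),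
      Module.Finite A I ∧ Module.Projective A I ∧ IsSES f g := by
  have hstep : ∀ n, Module.Finite A (C n) → ∃ (I : ModuleCat.{0} A) (f : C n →ₗ[A] I)
      (g : I →ₗ[A] C (n + 1)), Module.Finite A I ∧ Module.Projective A I ∧ IsSES f g := by
    intro n _
    obtain ⟨I, ι, p, hι, hp, hr⟩ := hC.2 n
    obtain ⟨hf, hproj⟩ := hι.finite_projective k
    exact ⟨I, ι.hom, p.hom, hf, hproj, hι.2.1, LinearMap.exact_iff.mpr hr.symm, hp⟩
  have hfin : Module.Finite A (C n) := by
    induction n with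
    | zero =>
      obtain ⟨e⟩ := hC.1
      exact Module.Finite.equiv e.symm.toLinearEquiv
    | succ n ih =>
      obtain ⟨I, f, g, hI, -, h⟩ := hstep n ih
      exact Module.Finite.of_surjective g h.surj
  exact ⟨hfin, hstep n hfin⟩

theorem IsMinInjCoresolution.isStep (k : Type) {A : Type} [Field k] [Ring A] [Algebra k A]
    [FiniteDimensional k A] [Module.Injective A A] {M : ModuleCat.{0} A} [Module.Finite A M]
    {C : ℕ → ModuleCat.{0} A} (hC : IsMinInjCoresolution A M C) (n : ℕ) :
    IsStep A (C n) (C (n + 1)) := by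
  obtain ⟨-, I, f, g, -, hp, h⟩ := hC.exists_isSES k n
  exact ⟨I, _, _, hp, f, g, h⟩

theorem MemAdd.exists_retract {A : Type} [Ring A] {M X : ModuleCat.{0} A} (h : MemAdd A M X) :
    ∃ (n : ℕ) (i : X →ₗ[A] (Fin n → M)) (r : (Fin n → M) →ₗ[A] X), r ∘ₗ i = LinearMap.id := by
  obtain ⟨n, Y, ⟨e⟩⟩ := h
  exact ⟨n, e.toLinearMap ∘ₗ LinearMap.inl A X Y, LinearMap.fst A X Y ∘ₗ e.symm.toLinearMap,
    by ext; simp⟩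

/-- A retract is a direct factor. -/
theorem exists_prod_equiv_of_retract {A X Y : Type} [Ring A] [AddCommGroup X] [Module A X]
    [AddCommGroup Y] [Module A Y] (i : X →ₗ[A] Y) (r : Y →ₗ[A] X) (h : r ∘ₗ i = LinearMap.id) :
    ∃ Z : ModuleCat.{0} A, Nonempty ((X × Z) ≃ₗ[A] Y) := by
  have hr : ∀ x, r (i x) = x := LinearMap.congr_fun h
  refine ⟨ModuleCat.of A (LinearMap.ker r), ⟨LinearEquiv.ofBijective
    (i.coprod (LinearMap.ker r).subtype) ⟨(injective_iff_map_eq_zero _).mpr ?_, fun y => ?_⟩⟩⟩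
  · rintro ⟨x, z, hz⟩ hxz
    have hz : r z = 0 := hz
    have hxz : i x + z = 0 := hxz
    have hx : x = 0 := by
      have := congrArg r hxz
      rwa [map_add, hr, hz, add_zero, map_zero] at this
    subst hx
    rw [map_zero, zero_add] at hxz
    exact Prod.ext rfl (Subtype.ext hxz)
  · exact ⟨(r y, ⟨y - i (r y), by simp [hr]⟩), by simp⟩

theorem memAdd_of_retract {A : Type} [Ring A] {M X : ModuleCat.{0} A} {n : ℕ}
    (i : X →ₗ[A] (Fin n → M)) (r : (Fin n → M) →ₗ[A] X) (h : r ∘ₗ i = LinearMap.id) :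
    MemAdd A M X :=
  ⟨n, exists_prod_equiv_of_retract i r h⟩

theorem IsStep.congr_left {A X X' Y : Type} [Ring A] [AddCommGroup X] [Module A X]
    [AddCommGroup X'] [Module A X'] [AddCommGroup Y] [Module A Y] (h : IsStep A X Y)
    (e : X' ≃ₗ[A] X) : IsStep A X' Y := by
  obtain ⟨P, _, _, hP, f, g, hfg⟩ := h
  exact ⟨P, _, _, hP, _, _, hfg.congr_left e⟩

/-- Stable homomorphisms from an orthogonal module into the cosyzygies vanish. -/
theorem stZero_cosyzygy (k : Type) {A : Type} [Field k] [Ring A] [Algebra k A]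
    [FiniteDimensional k A] [Module.Injective A A] {M : ModuleCat.{0} A} [Module.Finite A M]
    {C : ℕ → ModuleCat.{0} A} (hC : IsMinInjCoresolution A M C) {X : ModuleCat.{0} A} {n : ℕ}
    (hn : 1 ≤ n) (h : extZero A n X M) : StZero A X (C n) := by
  have := IsNoetherianRing.of_finite k A
  obtain ⟨n, rfl⟩ := Nat.exists_eq_add_of_le' hn
  obtain ⟨W, hW0, hWs⟩ : ∃ W : ℕ → ModuleCat.{0} A, W 0 = M ∧ ∀ i, W (i + 1) = C (i + 1) :=
    ⟨fun i => Nat.casesOn i M fun i => C (i + 1), rfl, fun _ => rfl⟩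
  have hW : ∀ i, IsStep A (W i) (W (i + 1)) := by
    rintro (_ | i)
    · rw [hW0, hWs]
      exact (hC.isStep k 0).congr_left hC.1.some.symm.toLinearEquiv
    · rw [hWs, hWs]
      exact hC.isStep k (i + 1)
  rw [← hWs]
  exact stZero_of_extZero hn hW (hW0.symm ▸ h)

/-- Stable homomorphisms from an orthogonal module into the Nakayama translates of the
cosyzygies vanish. -/
theorem stZero_nu_cosyzygy {k A : Type} [Field k] [Ring A] [Algebra k A]
    [FiniteDimensional k A] [Module.Injective A A] {M : ModuleCat.{0} A} [Module.Finite A M]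
    (hns : NakayamaStable k A M) {C : ℕ → ModuleCat.{0} A} (hC : IsMinInjCoresolution A M C)
    {X : ModuleCat.{0} A} {n : ℕ} (hn : 1 ≤ n) (h : extZero A n X M) :
    StZero A X (NuCarrier k A (C n)) := by
  have := IsNoetherianRing.of_finite k A
  have hX := isStep_extendLeft (isStep_cosyzygies k X)
  have hCs := isStep_extendLeft (hC.isStep k)
  have hν : ∀ i, IsStep A (NuMod k A (C i)) (NuMod k A (C (i + 1))) := fun i => by
    obtain ⟨-, I, f, g, _, _, hfg⟩ := hC.exists_isSES k i
    have := nu_injective k (A := A) I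
    exact ⟨NuCarrier k A I, _, _, projective_of_injective_of_finite k _, nuMap k f, nuMap k g,
      isSES_nuMap k hfg⟩
  have hνs := isStep_extendLeft hν
  have h0 : StZero A (extendLeft (cosyzygies k X) 0) (extendLeft C n) := stZero_cosyzygy k hC hn h
  rw [stZero_shift_int hX hCs _ _ (-n), add_neg_cancel] at h0
  have hret : MemAdd A M (NuMod k A M) := (hns _).mpr
    (memAdd_of_retract (n := 1) (LinearMap.pi fun _ => LinearMap.id) (LinearMap.proj 0) rfl)
  obtain ⟨m, i, r, hir⟩ := hret.exists_retract
  have h1 : StZero A (extendLeft (cosyzygies k X) (0 + -n)) (NuMod k A M) :=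
    (StZero.pi_right fun _ => h0.congr_right hC.1.some.toLinearEquiv).of_retract_right i r hir
  let e := hC.1.some.toLinearEquiv
  have h2 : StZero A (extendLeft (cosyzygies k X) (0 + -n))
    (extendLeft (fun i => NuMod k A (C i)) 0) := by
    have he : nuMap k e.symm.toLinearMap ∘ₗ nuMap k e.toLinearMap =
        LinearMap.id (R := A) (M := NuCarrier k A (C 0)) := by
      refine LinearMap.ext fun φ => LinearMap.ext fun f => ?_
      have : (f ∘ₗ e.symm.toLinearMap) ∘ₗ e.toLinearMap = f := by ext; simp
      exact congrArg φ this
    exact h1.of_retract_right (nuMap k e.toLinearMap) (nuMap k e.symm.toLinearMap) he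
  rw [stZero_shift_int hX hνs _ _ n, neg_add_cancel_right, zero_add] at h2
  exact h2

/-- Stable homomorphisms from all but two of the terms of a complete resolution of `M` to a module
in `𝒢` vanish. -/
theorem MemG.stZero {k A : Type} [Field k] [Ring A] [Algebra k A]
    [FiniteDimensional k A] [IsNoetherianRing A] [Module.Injective A A] {M : ModuleCat.{0} A}
    [Module.Finite A M]
    (hns : NakayamaStable k A M) {C : ℕ → ModuleCat.{0} A} (hC : IsMinInjCoresolution A M C)
    {X : ModuleCat.{0} A} (h : MemG A M X) {i : ℤ} (hi : i < 0 ∨ 1 < i) :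
    StZero A (extendLeft C i) X := by
  have hX := isStep_extendLeft (isStep_cosyzygies k X)
  have hCs := isStep_extendLeft (hC.isStep k)
  rcases hi with hi | hi
  · obtain ⟨n, rfl⟩ : ∃ n : ℕ, i = -n := ⟨i.natAbs, by omega⟩
    have h0 : StZero A (extendLeft C 0) (extendLeft (cosyzygies k X) n) :=
      (stZero_of_extZero (by omega) (isStep_cosyzygies k X) (h n (by omega)).1).congr_left
        hC.1.some.symm.toLinearEquiv
    rw [stZero_shift_int hCs hX _ _ (-n), add_neg_cancel, zero_add] at h0
    exact h0
  · obtain ⟨n, rfl⟩ : ∃ n : ℕ, i = (n + 2 : ℕ) := ⟨(i - 2).toNat, by omega⟩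
    obtain ⟨-, P, f, ρ, _, _, hP⟩ := hC.exists_isSES k n
    obtain ⟨-, Q, ι, π, _, _, hQ⟩ := hC.exists_isSES k (n + 1)
    exact stZero_of_lift_nu k ρ hQ fun u =>
      (stZero_nu_cosyzygy hns hC (by omega) (h (n + 1) (by omega)).2 u).exists_lift
        (isSES_nuMap k hP).surj

theorem stZero_extendLeft {k A : Type} [Field k] [Ring A] [Algebra k A]
    [FiniteDimensional k A] [IsNoetherianRing A] [Module.Injective A A] {M : ModuleCat.{0} A}
    [Module.Finite A M] (hso : SelfOrthogonal A M)
    (hns : NakayamaStable k A M) {C : ℕ → ModuleCat.{0} A} (hC : IsMinInjCoresolution A M C)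
    {i j : ℤ} (hij : i < j ∨ j + 1 < i) :
    StZero A (extendLeft C i) (extendLeft C j) := by
  have hCs := isStep_extendLeft (hC.isStep k)
  rw [stZero_shift_int hCs hCs _ _ (-j), add_neg_cancel]
  have hM : MemG A M M := fun n hn => ⟨hso n hn, hso n hn⟩
  exact (hM.stZero hns hC (by omega)).congr_right hC.1.some.symm.toLinearEquiv

end Cosyzygies

section StableFiniteness

theorem linearMap_sum_comp {A X Y Z ι : Type} [Ring A] [AddCommGroup X] [Module A X]
    [AddCommGroup Y] [Module A Y] [AddCommGroup Z] [Module A Z] (s : Finset ι)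
    (f : ι → Y →ₗ[A] Z) (g : X →ₗ[A] Y) : (∑ i ∈ s, f i) ∘ₗ g = ∑ i ∈ s, f i ∘ₗ g := by
  ext; simp

theorem linearMap_comp_sum {A X Y Z ι : Type} [Ring A] [AddCommGroup X] [Module A X]
    [AddCommGroup Y] [Module A Y] [AddCommGroup Z] [Module A Z] (s : Finset ι)
    (f : Y →ₗ[A] Z) (g : ι → X →ₗ[A] Y) : f ∘ₗ (∑ i ∈ s, g i) = ∑ i ∈ s, f ∘ₗ g i := by
  ext; simp

theorem comp_centralSmulLin {k A X Y : Type} [Field k] [Ring A] [Algebra k A] [AddCommGroup X]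
    [Module A X] [AddCommGroup Y] [Module A Y] (f : X →ₗ[A] Y) (c : k) :
    f ∘ₗ centralSmulLin k A c X = centralSmulLin k A c Y ∘ₗ f :=
  LinearMap.ext fun x => map_smul f (algebraMap k A c) x

/-- The stable Hom-group from `X` to `Y` is finite-dimensional. -/
def StFin (k A X Y : Type) [Field k] [Ring A] [Algebra k A] [AddCommGroup X] [Module A X]
    [AddCommGroup Y] [Module A Y] : Prop :=
  ∃ (m : ℕ) (f : Fin m → X →ₗ[A] Y), ∀ g : X →ₗ[A] Y, ∃ c : Fin m → k,
    IsNull (g - ∑ j, f j ∘ₗ centralSmulLin k A (c j) X)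

variable {k A X Y Z W T T' P : Type} [Field k] [Ring A] [Algebra k A] [AddCommGroup X] [Module A X]
  [AddCommGroup Y] [Module A Y] [AddCommGroup Z] [Module A Z] [AddCommGroup W] [Module A W]
  [AddCommGroup T] [Module A T] [AddCommGroup T'] [Module A T'] [AddCommGroup P] [Module A P]

theorem StZero.stFin (h : StZero A X Y) : StFin k A X Y :=
  ⟨0, fun _ => 0, fun g => ⟨0, by simpa using h g⟩⟩

theorem StHomProjFinDim.stFin {X Y : ModuleCat.{0} A} (h : StHomProjFinDim k A X Y) :
    StFin k A X Y := by
  obtain ⟨m, f, hf⟩ := h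
  refine ⟨m, fun j => (f j).hom, fun g => ?_⟩
  obtain ⟨c, P, hP, u, v, huv⟩ := hf (ModuleCat.ofHom g)
  refine ⟨c, P, _, _, hP, u.hom, v.hom, ?_⟩
  have := congrArg ModuleCat.Hom.hom huv
  simpa using this

theorem StFin.congr_left (h : StFin k A X Y) (e : T ≃ₗ[A] X) : StFin k A T Y := by
  obtain ⟨m, f, hf⟩ := h
  refine ⟨m, fun j => f j ∘ₗ e.toLinearMap, fun g => ?_⟩
  obtain ⟨c, hc⟩ := hf (g ∘ₗ e.symm.toLinearMap)
  refine ⟨c, ?_⟩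
  convert hc.precomp e.toLinearMap using 1
  rw [LinearMap.sub_comp, linearMap_sum_comp]
  congr 1
  · ext; simp
  · simp only [LinearMap.comp_assoc, comp_centralSmulLin]

/-- Finite-dimensionality of stable Hom-groups is invariant under stable isomorphism. -/
theorem StFin.of_stable_retract (h : StFin k A X Y) (s : Y →ₗ[A] Z) (p : Z →ₗ[A] Y)
    (hsp : IsNull (LinearMap.id - s ∘ₗ p)) : StFin k A X Z := by
  obtain ⟨m, f, hf⟩ := h
  refine ⟨m, fun j => s ∘ₗ f j, fun g => ?_⟩
  obtain ⟨c, hc⟩ := hf (p ∘ₗ g)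
  refine ⟨c, ?_⟩
  convert (hc.comp s).add (hsp.precomp g) using 1
  ext x
  simp

/-- Stable vanishing for the cokernel of a map killing all stable maps from `T'`. -/
theorem stZero_of_killing [IsNoetherianRing A] [Module.Injective A A] [Module.Projective A P]
    {a : T →ₗ[A] P} {b : P →ₗ[A] T'} (hT : IsSES a b) {w : W →ₗ[A] Y} {q : Y →ₗ[A] Z}
    (h : IsSES w q) (hkill : ∀ f : T' →ₗ[A] Y, IsNull (q ∘ₗ f)) (hW : StZero A T W) :
    StZero A T' Z := fun u => by
  obtain ⟨v, hv⟩ := Module.projective_lifting_property q (u ∘ₗ b) h.surj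
  obtain ⟨s, hs⟩ := h.exists_lift (v ∘ₗ a) (by
    rw [← LinearMap.comp_assoc, hv, LinearMap.comp_assoc, hT.comp_eq_zero, LinearMap.comp_zero])
  obtain ⟨s', -, hs'⟩ := (hW s).exists_extension hT.inj
  obtain ⟨t, ht⟩ := hT.exists_desc (v - w ∘ₗ s') (by
    rw [LinearMap.sub_comp, LinearMap.comp_assoc, hs', hs, sub_self])
  have : q ∘ₗ t = u := by
    refine (LinearMap.cancel_right hT.surj).mp ?_
    rw [LinearMap.comp_assoc, ht, LinearMap.comp_sub, ← LinearMap.comp_assoc, h.comp_eq_zero,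
      LinearMap.zero_comp, sub_zero, hv]
  exact this ▸ hkill t

/-- Stable finite-dimensionality for the cokernel of a map killing all stable maps from `T'`. -/
theorem stFin_of_killing [FiniteDimensional k A] [Module.Finite A T] [Module.Finite A W]
    [Module.Projective A P]
    {a : T →ₗ[A] P} {b : P →ₗ[A] T'} (hT : IsSES a b) {w : W →ₗ[A] Y} {q : Y →ₗ[A] Z}
    (h : IsSES w q) (hkill : ∀ f : T' →ₗ[A] Y, IsNull (q ∘ₗ f)) : StFin k A T' Z := by
  let _ : Module k W := restrictedModule k (A := A) W
  have : IsScalarTower k A W := restrictedModule_isScalarTower k W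
  have hsmul : ∀ (c : k) (s : T →ₗ[A] W), c • s = s ∘ₗ centralSmulLin k A c T := fun c s =>
    LinearMap.ext fun x => (map_smul s (algebraMap k A c) x).symm
  let H : Submodule k (T →ₗ[A] W) :=
    { carrier := {s | ∃ v : P →ₗ[A] Y, v ∘ₗ a = w ∘ₗ s}
      zero_mem' := ⟨0, by simp⟩
      add_mem' := by
        rintro s s' ⟨v, hv⟩ ⟨v', hv'⟩
        exact ⟨v + v', by rw [LinearMap.add_comp, hv, hv', LinearMap.comp_add]⟩
      smul_mem' := by
        rintro c s ⟨v, hv⟩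
        refine ⟨v ∘ₗ centralSmulLin k A c P, ?_⟩
        rw [hsmul, LinearMap.comp_assoc, ← comp_centralSmulLin, ← LinearMap.comp_assoc, hv,
          LinearMap.comp_assoc] }
  have : FiniteDimensional k (T →ₗ[A] W) := finiteDimensional_linearMap_of_finite k
  let β := Module.finBasis k H
  choose v hv using fun j => (β j).2
  choose u hu using fun j => hT.exists_desc (q ∘ₗ v j) (by
    rw [LinearMap.comp_assoc, hv, ← LinearMap.comp_assoc, h.comp_eq_zero, LinearMap.zero_comp])
  refine ⟨_, u, fun g => ?_⟩
  obtain ⟨v', hv'⟩ := Module.projective_lifting_property q (g ∘ₗ b) h.surj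
  obtain ⟨s, hs⟩ := h.exists_lift (v' ∘ₗ a) (by
    rw [← LinearMap.comp_assoc, hv', LinearMap.comp_assoc, hT.comp_eq_zero, LinearMap.comp_zero])
  let c := β.repr ⟨s, v', hs.symm⟩
  have hc : s = ∑ j, (β j : T →ₗ[A] W) ∘ₗ centralSmulLin k A (c j) T := by
    have := congrArg Subtype.val (β.sum_repr ⟨s, v', hs.symm⟩)
    refine this.symm.trans ?_
    simp only [Submodule.coe_sum, Submodule.coe_smul, hsmul, c]
  refine ⟨c, ?_⟩
  obtain ⟨t, ht⟩ := hT.exists_desc (v' - ∑ j, v j ∘ₗ centralSmulLin k A (c j) P) (by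
    rw [LinearMap.sub_comp, linearMap_sum_comp, ← hs, hc, linearMap_comp_sum, sub_eq_zero]
    refine Finset.sum_congr rfl fun j _ => ?_
    rw [← LinearMap.comp_assoc, ← hv, LinearMap.comp_assoc, LinearMap.comp_assoc,
      comp_centralSmulLin a])
  have : q ∘ₗ t = g - ∑ j, u j ∘ₗ centralSmulLin k A (c j) T' := by
    refine (LinearMap.cancel_right hT.surj).mp ?_
    rw [LinearMap.comp_assoc, ht, LinearMap.comp_sub, linearMap_comp_sum, hv', LinearMap.sub_comp,
      linearMap_sum_comp]
    congr 1
    refine Finset.sum_congr rfl fun j _ => ?_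
    rw [← LinearMap.comp_assoc, ← hu, LinearMap.comp_assoc, LinearMap.comp_assoc,
      comp_centralSmulLin b]
  exact this ▸ hkill t

end StableFiniteness

section FreshQuotient

variable {A X E W : Type} [Ring A] [AddCommGroup X] [Module A X] [AddCommGroup E] [Module A E]
  [AddCommGroup W] [Module A W]

theorem Submodule.FG.exists_le_of_le_iSup {N : Submodule A E} (hN : N.FG)
    {F : ℕ → Submodule A E} (hF : Monotone F) (h : N ≤ ⨆ n, F n) : ∃ n, N ≤ F n := by
  obtain ⟨_, ⟨n, rfl⟩, hn⟩ := (Submodule.fg_iff_compact N).mp hN (Set.range F) (⨆ n, F n)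
    (Set.range_nonempty F) hF.directed_le.directedOn_range isLUB_iSup h
  exact ⟨n, hn⟩

theorem fg_comap_mkQ_range [Module.Finite A W] {N : Submodule A E} (hN : N.FG)
    (f : W →ₗ[A] E ⧸ N) : ((LinearMap.range f).comap N.mkQ).FG := by
  refine Submodule.fg_of_fg_map_of_fg_inf_ker N.mkQ ?_ ?_
  · rw [Submodule.map_comap_eq_of_surjective N.mkQ_surjective]
    exact Module.Finite.iff_fg.mp inferInstance
  · rw [Submodule.ker_mkQ, inf_eq_right.mpr (Submodule.le_comap_mkQ N _)]
    exact hN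

theorem isSES_factor {N N' : Submodule A E} (h : N ≤ N') {w : W →ₗ[A] E ⧸ N}
    (hw : Function.Injective w) (hN' : N' = (LinearMap.range w).comap N.mkQ) :
    IsSES w (Submodule.factor h) where
  inj := hw
  surj := Submodule.factor_surjective h
  exact := fun y => by
    obtain ⟨e, rfl⟩ := N.mkQ_surjective y
    have : Submodule.factor h (N.mkQ e) = N'.mkQ e := rfl
    rw [this, Submodule.mkQ_apply, Submodule.Quotient.mk_eq_zero, hN']
    rfl

theorem nonempty_subquotient_equiv {N N' : Submodule A E} {w : W →ₗ[A] E ⧸ N}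
    (hw : Function.Injective w) (hN' : N' = (LinearMap.range w).comap N.mkQ) :
    Nonempty ((N' ⧸ N.comap N'.subtype) ≃ₗ[A] W) := by
  have hker : N.comap N'.subtype = LinearMap.ker (N.mkQ ∘ₗ N'.subtype) := by
    rw [LinearMap.ker_comp, Submodule.ker_mkQ]
  have hrange : LinearMap.range (N.mkQ ∘ₗ N'.subtype) = LinearMap.range w := by
    rw [LinearMap.range_comp, Submodule.range_subtype, hN',
      Submodule.map_comap_eq_of_surjective N.mkQ_surjective]
  exact ⟨Submodule.quotEquivOfEq _ _ hker ≪≫ₗ LinearMap.quotKerEquivRange _ ≪≫ₗ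
    LinearEquiv.ofEq _ _ hrange ≪≫ₗ (LinearEquiv.ofInjective w hw).symm⟩

/-- A map from a finitely generated module `W` to a quotient of `X ⊕ A^(ℕ)` by a finitely
generated submodule is stably equivalent to a monomorphism. -/
theorem exists_mono_stably_eq (k : Type) [Field k] [Algebra k A] [FiniteDimensional k A]
    [Module.Injective A A] [Module.Finite A W] {N : Submodule A (X × (ℕ →₀ A))} (hN : N.FG)
    (ev : W →ₗ[A] (X × (ℕ →₀ A)) ⧸ N) :
    ∃ w : W →ₗ[A] (X × (ℕ →₀ A)) ⧸ N, Function.Injective w ∧ IsNull (w - ev) := by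
  let L : ℕ → Submodule A (X × (ℕ →₀ A)) := fun c =>
    (Finsupp.supported A A {n | n < c}).comap (LinearMap.snd A X (ℕ →₀ A))
  have hL : Monotone L := fun c d hcd =>
    Submodule.comap_mono (Finsupp.supported_mono fun n hn => lt_of_lt_of_le hn hcd)
  have hLtop : ∀ e, e ∈ ⨆ c, L c := by
    intro e
    refine (Submodule.mem_iSup_of_directed L hL.directed_le).mpr
      ⟨e.2.support.sup id + 1, (Finsupp.mem_supported A _).mpr fun n hn => ?_⟩
    exact Nat.lt_succ_of_le (Finset.le_sup (f := id) hn)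
  obtain ⟨c, hc⟩ := (fg_comap_mkQ_range hN ev).exists_le_of_le_iSup hL fun e _ => hLtop e
  obtain ⟨m, i, hi⟩ := exists_embedding_free k (A := A) W
  let J₀ : (Fin m → A) →ₗ[A] (ℕ →₀ A) := Finsupp.lmapDomain A A (fun i : Fin m => c + (i : ℕ)) ∘ₗ
    (Finsupp.linearEquivFunOnFinite A A (Fin m)).symm.toLinearMap
  have hJ₀ : Function.Injective J₀ := by
    refine (Finsupp.mapDomain_injective fun i j hij => ?_).comp (LinearEquiv.injective _)
    exact Fin.ext (Nat.add_left_cancel hij)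
  have hJ₀' : ∀ y n, n < c → J₀ y n = 0 := by
    intro y n hn
    refine Finsupp.mapDomain_of_notMem_range _ _ ?_
    rintro ⟨j, rfl⟩
    exact absurd hn (by simp)
  let J : W →ₗ[A] X × (ℕ →₀ A) := LinearMap.inr A X (ℕ →₀ A) ∘ₗ J₀ ∘ₗ i
  refine ⟨ev + N.mkQ ∘ₗ J, (injective_iff_map_eq_zero _).mpr fun x hx => ?_, ?_⟩
  · obtain ⟨e, he⟩ := N.mkQ_surjective (ev x)
    have hmem : e + J x ∈ N := by
      rw [← Submodule.Quotient.mk_eq_zero, ← Submodule.mkQ_apply, map_add, he]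
      exact hx
    have hJx : J x ∈ L c := by
      have h1 : e ∈ L c := hc ⟨x, he.symm⟩
      have h2 : e + J x ∈ L c := hc (Submodule.le_comap_mkQ N _ hmem)
      simpa using (L c).sub_mem h2 h1
    have hzero : J₀ (i x) = 0 := by
      ext n
      by_cases hn : n < c
      · exact hJ₀' _ n hn
      · by_contra hne
        exact hn ((Finsupp.mem_supported A _).mp hJx (Finsupp.mem_support_iff.mpr hne))
    exact hi (hJ₀ (by rw [hzero, map_zero, map_zero]))
  · rw [add_sub_cancel_left]
    exact ⟨Fin m → A, _, _, inferInstance, i, N.mkQ ∘ₗ LinearMap.inr A X (ℕ →₀ A) ∘ₗ J₀, rfl⟩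

end FreshQuotient

section KillingStep

variable {A E : Type} [Ring A] [AddCommGroup E] [Module A E]

/-- A finitely generated submodule `N` of `E` such that the stable Hom-groups from `D i` to the
quotient `E ⧸ N` are finite-dimensional, and vanish for `i < n` and for large `i`. -/
structure IsKillingStage (k : Type) [Field k] [Algebra k A] (D : ℤ → ModuleCat.{0} A) (n : ℕ)
    (N : Submodule A E) : Prop where
  fg : N.FG
  stZero_of_lt : ∀ i : ℤ, i < n → StZero A (D i) (E ⧸ N)
  stZero_of_gt : ∃ B : ℕ, ∀ i : ℤ, (B : ℤ) < i → StZero A (D i) (E ⧸ N)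
  stFin : ∀ i, StFin k A (D i) (E ⧸ N)

/-- `N ≤ N'`, the quotient `N' / N` is a finite direct sum of modules `D t` with `n ≤ t`, and
`E ⧸ N → E ⧸ N'` stably annihilates all maps from the modules `D i`. -/
structure IsKillingStep (D : ℤ → ModuleCat.{0} A) (n : ℕ) (N N' : Submodule A E) : Prop where
  le : N ≤ N'
  exists_equiv : ∃ (ι : Type) (_ : Fintype ι) (T : ι → ℕ), (∀ j, n ≤ T j) ∧
    Nonempty ((N' ⧸ N.comap N'.subtype) ≃ₗ[A] ((j : ι) → D (T j : ℤ)))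
  isNull_comp : ∀ i (f : D i →ₗ[A] E ⧸ N), IsNull (Submodule.factor le ∘ₗ f)

theorem IsKillingStage.exists_isKillingStep {k X : Type} [AddCommGroup X] [Module A X]
    [Field k] [Algebra k A]
    [FiniteDimensional k A] [Module.Injective A A] [IsNoetherianRing A] {D : ℤ → ModuleCat.{0} A}
    (hfin : ∀ i, Module.Finite A (D i)) (hstep : ∀ i, IsStep A (D i) (D (i + 1)))
    (horth : ∀ i j, i < j ∨ j + 1 < i → StZero A (D i) (D j)) {n : ℕ}
    {N : Submodule A (X × (ℕ →₀ A))} (h : IsKillingStage k D n N) :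
    ∃ N', IsKillingStage k D (n + 1) N' ∧ IsKillingStep D n N N' := by
  classical
  obtain ⟨B, hB⟩ := h.stZero_of_gt
  choose m f hf using h.stFin
  let ι : Type := Σ i : Fin (B + 1), Fin (m ((n + i : ℕ) : ℤ))
  let T : ι → ℕ := fun j => n + j.1
  let W : Type := (j : ι) → D (T j : ℤ)
  let ev : W →ₗ[A] (X × (ℕ →₀ A)) ⧸ N := LinearMap.lsum A (fun j : ι => D (T j : ℤ)) ℕ
    fun j => f (T j : ℤ) j.2
  have : Module.Finite A W := Module.Finite.pi
  obtain ⟨w, hw, hnull⟩ := exists_mono_stably_eq k h.fg ev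
  let N' := (LinearMap.range w).comap N.mkQ
  have hle : N ≤ N' := Submodule.le_comap_mkQ N _
  have hses : IsSES w (Submodule.factor hle) := isSES_factor hle hw rfl
  have hev : IsNull (Submodule.factor hle ∘ₗ ev) := by
    have := (hnull.comp (Submodule.factor hle)).neg
    rwa [LinearMap.comp_sub, hses.comp_eq_zero, zero_sub, neg_neg] at this
  have hkill : ∀ i (g : D i →ₗ[A] (X × (ℕ →₀ A)) ⧸ N), IsNull (Submodule.factor hle ∘ₗ g) := by
    intro i g
    by_cases hi : i < n
    · exact (h.stZero_of_lt i hi g).comp _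
    by_cases hi' : (B : ℤ) < i
    · exact (hB i hi' g).comp _
    obtain ⟨l, rfl⟩ : ∃ l : Fin (B + 1), i = ((n + l : ℕ) : ℤ) :=
      ⟨⟨(i - n).toNat, by omega⟩, by simp only; omega⟩
    obtain ⟨c, hc⟩ := hf _ g
    have hsum : IsNull (Submodule.factor hle ∘ₗ
        ∑ j, f ((n + l : ℕ) : ℤ) j ∘ₗ centralSmulLin k A (c j) (D ((n + l : ℕ) : ℤ))) := by
      rw [linearMap_comp_sum]
      refine IsNull.sum _ fun j _ => ?_
      have : f ((n + l : ℕ) : ℤ) j =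
          ev ∘ₗ LinearMap.single A (fun j : ι => D (T j : ℤ)) ⟨l, j⟩ := by
        ext x
        exact (LinearMap.lsum_piSingle A (fun j : ι => D (T j : ℤ)) ℕ
          (fun j : ι => f (T j : ℤ) j.2) ⟨l, j⟩ x).symm
      rw [this, LinearMap.comp_assoc, ← LinearMap.comp_assoc]
      exact hev.precomp _
    have := (hc.comp (Submodule.factor hle)).add hsum
    rwa [← LinearMap.comp_add, sub_add_cancel] at this
  have hstep' : ∀ i, IsStep A (D (i - 1)) (D i) := by
    intro i
    have := hstep (i - 1)
    rwa [sub_add_cancel] at this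
  refine ⟨N', ⟨fg_comap_mkQ_range h.fg w, fun i hi => ?_, ⟨n + B + 2, fun i hi => ?_⟩, fun i => ?_⟩,
    hle, ⟨ι, inferInstance, T, fun j => Nat.le_add_right _ _, nonempty_subquotient_equiv hw rfl⟩,
    hkill⟩
  · obtain ⟨P, _, _, hP, a, b, hab⟩ := hstep' i
    refine stZero_of_killing hab hses (hkill i) (StZero.pi_right fun j => horth _ _ (Or.inl ?_))
    simp only [T]
    push_cast at hi ⊢
    omega
  · obtain ⟨P, _, _, hP, a, b, hab⟩ := hstep' i
    refine stZero_of_killing hab hses (hkill i) (StZero.pi_right fun j => horth _ _ (Or.inr ?_))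
    have := j.1.2
    simp only [T]
    push_cast at hi ⊢
    omega
  · obtain ⟨P, _, _, hP, a, b, hab⟩ := hstep' i
    exact stFin_of_killing hab hses (hkill i)

end KillingStep

section Filtration

variable {A E T Y : Type} [Ring A] [AddCommGroup E] [Module A E]
  [AddCommGroup T] [Module A T] [AddCommGroup Y] [Module A Y]

theorem exists_surjective_projective (A Y : Type) [Ring A] [AddCommGroup Y] [Module A Y] :
    ∃ (P : Type) (_ : AddCommGroup P) (_ : Module A P) (_ : Module.Projective A P)
      (p : P →ₗ[A] Y), Function.Surjective p :=
  ⟨Y →₀ A, _, _, inferInstance, Finsupp.linearCombination A id,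
    Finsupp.linearCombination_id_surjective A Y⟩

/-- A compatible sequence of maps on a chain of submodules glues to a map on the union. -/
theorem exists_glue_iSup {F : ℕ → Submodule A E} (hF : Monotone F) (g : ℕ → E →ₗ[A] T)
    (hg : ∀ n, ∀ x ∈ F n, g (n + 1) x = g n x) :
    ∃ G : ↥(⨆ n, F n) →ₗ[A] T, ∀ n (x : ↥(⨆ n, F n)), (x : E) ∈ F n → G x = g n x := by
  have hle : ∀ n m, n ≤ m → ∀ x ∈ F n, g m x = g n x := by
    intro n m hnm
    induction m, hnm using Nat.le_induction with
    | base => exact fun _ _ => rfl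
    | succ m hm ih => exact fun x hx => (hg m x (hF hm hx)).trans (ih x hx)
  have hind : ∀ n m, ∀ x ∈ F n, x ∈ F m → g m x = g n x := by
    intro n m x hn hm
    rcases le_total n m with h | h
    · exact hle n m h x hn
    · exact (hle m n h x hm).symm
  choose l hl using fun x : ↥(⨆ n, F n) =>
    (Submodule.mem_iSup_of_directed F hF.directed_le).mp x.2
  refine ⟨
    { toFun := fun x => g (l x) x
      map_add' := fun x y => ?_
      map_smul' := fun a x => ?_ }, fun n x hx => hind n _ x hx (hl x)⟩
  · have hx := hF (le_max_left (l x) (l y)) (hl x)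
    have hy := hF (le_max_right (l x) (l y)) (hl y)
    rw [Submodule.coe_add, hind _ (l (x + y)) _ ((F _).add_mem hx hy) (hl (x + y)), map_add,
      hind (l x) _ x (hl x) hx, hind (l y) _ y (hl y) hy]
  · rw [Submodule.coe_smul, hind (l x) (l (a • x)) _ ((F _).smul_mem a (hl x)) (hl (a • x)), map_smul]
    rfl

/-- A map vanishing on `F 0` agrees with a stably trivial map on the union of a chain of
submodules whose subquotients have no stable maps to the target. -/
theorem exists_isNull_eq_on_iSup [IsNoetherianRing A] [Module.Injective A A]
    {F : ℕ → Submodule A E} (hF : Monotone F)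
    (hsub : ∀ n, StZero A (F (n + 1) ⧸ (F n).comap (F (n + 1)).subtype) Y) (f : E →ₗ[A] Y)
    (h0 : ∀ x ∈ F 0, f x = 0) :
    ∃ g : E →ₗ[A] Y, IsNull g ∧ ∀ x ∈ ⨆ n, F n, g x = f x := by
  obtain ⟨P, _, _, _, p, hp⟩ := exists_surjective_projective A Y
  have := injective_of_projective (A := A) P
  have hnext : ∀ n (g : {g : E →ₗ[A] P // ∀ x ∈ F n, p (g x) = f x}),
      ∃ g' : {g : E →ₗ[A] P // ∀ x ∈ F (n + 1), p (g x) = f x}, ∀ x ∈ F n, g'.1 x = g.1 x := by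
    rintro n ⟨g, hg⟩
    obtain ⟨u, hu⟩ := (isSES_mkQ ((F n).comap (F (n + 1)).subtype)).exists_desc
      ((f - p ∘ₗ g) ∘ₗ (F (n + 1)).subtype) (by
        ext x
        simpa [sub_eq_zero] using (hg _ x.2).symm)
    obtain ⟨v, hv⟩ := (hsub n u).exists_lift hp
    obtain ⟨r, hr⟩ := exists_extension (F (n + 1)).injective_subtype
      (v ∘ₗ ((F n).comap (F (n + 1)).subtype).mkQ)
    refine ⟨⟨g + r, fun x hx => ?_⟩, fun x hx => ?_⟩
    · have h1 := LinearMap.congr_fun hr ⟨x, hx⟩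
      have h2 := LinearMap.congr_fun hu ⟨x, hx⟩
      rw [← hv, LinearMap.comp_assoc, ← hr] at h2
      simp only [LinearMap.comp_apply, Submodule.subtype_apply, LinearMap.sub_apply] at h2
      simp [h2]
    · have h1 := LinearMap.congr_fun hr ⟨x, hF n.le_succ hx⟩
      have h2 : ((F n).comap (F (n + 1)).subtype).mkQ ⟨x, hF n.le_succ hx⟩ = 0 := by
        rw [Submodule.mkQ_apply, Submodule.Quotient.mk_eq_zero]
        exact hx
      rw [LinearMap.comp_apply, LinearMap.comp_apply, h2, map_zero] at h1
      simpa using h1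
  choose next hnext using hnext
  let g : ∀ n, {g : E →ₗ[A] P // ∀ x ∈ F n, p (g x) = f x} := fun n =>
    Nat.rec ⟨0, fun x hx => by simp [h0 x hx]⟩ next n
  obtain ⟨G, hG⟩ := exists_glue_iSup hF (fun n => (g n).1) fun n => hnext n (g n)
  obtain ⟨r, hr⟩ := exists_extension (⨆ n, F n).injective_subtype G
  refine ⟨p ∘ₗ r, ⟨P, _, _, inferInstance, r, p, rfl⟩, fun x hx => ?_⟩
  obtain ⟨n, hn⟩ := (Submodule.mem_iSup_of_directed F hF.directed_le).mp hx
  have := LinearMap.congr_fun hr ⟨x, hx⟩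
  rw [hG n _ hn] at this
  exact (congrArg p this).trans ((g n).2 x hn)

theorem nonempty_comap_subquotient_equiv {N N' K : Submodule A E} (h' : N' ≤ K) :
    Nonempty ((N'.comap K.subtype ⧸ (N.comap K.subtype).comap (N'.comap K.subtype).subtype) ≃ₗ[A]
      N' ⧸ N.comap N'.subtype) := by
  refine ⟨Submodule.Quotient.equiv _ _ (Submodule.comapSubtypeEquivOfLe h') ?_⟩
  ext x
  constructor
  · rintro ⟨y, hy, rfl⟩
    exact hy
  · intro hx
    exact ⟨(Submodule.comapSubtypeEquivOfLe h').symm x, hx, LinearEquiv.apply_symm_apply _ _⟩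

theorem iSup_comap_subtype {F : ℕ → Submodule A E} (hF : Monotone F) :
    ⨆ n, (F n).comap (⨆ n, F n).subtype = ⊤ := by
  refine eq_top_iff.mpr fun x _ => ?_
  obtain ⟨n, hn⟩ := (Submodule.mem_iSup_of_directed F hF.directed_le).mp x.2
  exact Submodule.mem_iSup_of_mem n hn

/-- The union of a chain of submodules has no stable maps to `Y` if the subquotients do not. -/
theorem stZero_iSup [IsNoetherianRing A] [Module.Injective A A]
    {F : ℕ → Submodule A E} (hF : Monotone F) (h0 : F 0 = ⊥)
    (hsub : ∀ n, StZero A (F (n + 1) ⧸ (F n).comap (F (n + 1)).subtype) Y) :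
    StZero A ↥(⨆ n, F n) Y := fun f => by
  obtain ⟨g, hg, hgf⟩ := exists_isNull_eq_on_iSup
    (F := fun n => (F n).comap (⨆ n, F n).subtype)
    (fun n m hnm => Submodule.comap_mono (hF hnm)) (fun n => by
      obtain ⟨e⟩ := nonempty_comap_subquotient_equiv (N := F n) (le_iSup F (n + 1))
      exact (hsub n).congr_left e.symm) f (fun x hx => by
        have : x = 0 := Subtype.ext (by simpa [h0] using hx)
        rw [this, map_zero])
  have : g = f := LinearMap.ext fun x => hgf x (by rw [iSup_comap_subtype hF]; trivial)
  exact this ▸ hg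

/-- A map from a finitely presented module to the colimit `E ⧸ ⨆ F n` factors through some
`E ⧸ F n`. -/
theorem exists_factor_comp_eq [IsNoetherianRing A] [Module.Finite A T] {F : ℕ → Submodule A E}
    (hF : Monotone F) (f : T →ₗ[A] E ⧸ ⨆ n, F n) :
    ∃ n, ∃ g : T →ₗ[A] E ⧸ F n, Submodule.factor (le_iSup F n) ∘ₗ g = f := by
  obtain ⟨m, p, hp⟩ := Module.Finite.exists_fin' A T
  obtain ⟨h, hh⟩ := Module.projective_lifting_property (⨆ n, F n).mkQ (f ∘ₗ p)
    (⨆ n, F n).mkQ_surjective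
  have hfg : ((LinearMap.ker p).map h).FG := (IsNoetherian.noetherian _).map h
  obtain ⟨n, hn⟩ := hfg.exists_le_of_le_iSup hF (by
    rintro _ ⟨x, hx, rfl⟩
    have := LinearMap.congr_fun hh x
    rw [LinearMap.comp_apply, LinearMap.comp_apply, LinearMap.mem_ker.mp hx, map_zero] at this
    exact (Submodule.Quotient.mk_eq_zero _).mp this)
  obtain ⟨g, hg⟩ := (isSES_ker hp).exists_desc ((F n).mkQ ∘ₗ h) (by
    ext x
    exact (Submodule.Quotient.mk_eq_zero _).mpr (hn ⟨x, x.2, rfl⟩))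
  refine ⟨n, g, (LinearMap.cancel_right hp).mp ?_⟩
  rw [LinearMap.comp_assoc, hg, ← hh]
  rfl

end Filtration

section KillingFiltration

variable {k A : Type} [Field k] [Ring A] [Algebra k A]

theorem IsNull.projective {Y : Type} [AddCommGroup Y] [Module A Y]
    (h : IsNull (LinearMap.id : Y →ₗ[A] Y)) : Module.Projective A Y := by
  obtain ⟨P, _, _, hP, u, v, huv⟩ := h
  exact Module.Projective.of_split u v huv.symm

/-- The modules without stable maps to any term of `T` form a class of the kind defining `𝒮`. -/
theorem isSClosedClass_stZero [IsNoetherianRing A] [Module.Injective A A] {M : ModuleCat.{0} A}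
    {T : ℤ → ModuleCat.{0} A} (hT : ∀ i, IsStep A (T i) (T (i + 1)))
    (hM : ∀ j, StZero A M (T j)) :
    IsSClosedClass A M fun X => ∀ j, StZero A X (T j) := by
  refine ⟨hM, ?_, ?_, ?_, ?_⟩
  · rintro X Y h ⟨e⟩ j
    exact (h j).congr_left e.toLinearEquiv
  · rintro X Y h ⟨i, r, hir⟩ j
    exact (h j).of_retract_left i.hom r.hom (congrArg ModuleCat.Hom.hom hir)
  · intro I Y h j f
    obtain ⟨P, _, _, hP, p, hp⟩ := exists_surjective_projective A (T j)
    choose u hu using fun i => (h i j (f ∘ₗ (Limits.Sigma.ι Y i).hom)).exists_lift hp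
    refine ⟨P, _, _, hP, (Limits.Sigma.desc fun i => ModuleCat.ofHom (u i)).hom, p, ?_⟩
    have : ModuleCat.ofHom f =
        (Limits.Sigma.desc fun i => ModuleCat.ofHom (u i)) ≫ ModuleCat.ofHom p := by
      refine Limits.Sigma.hom_ext _ _ fun i => ?_
      rw [Limits.Sigma.ι_desc_assoc]
      ext x
      exact (LinearMap.congr_fun (hu i) x).symm
    exact congrArg ModuleCat.Hom.hom this
  · intro X Y Z f g hf hg hfg
    have hses : IsSES f.hom g.hom := ⟨hf, LinearMap.exact_iff.mpr hfg.symm, hg⟩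
    have hT' : ∀ i, IsStep A (T (i - 1)) (T i) := by
      intro i
      have := hT (i - 1)
      rwa [sub_add_cancel] at this
    exact ⟨fun h j => StZero.right hses (hT' j) (h.1 _) (h.2 j),
      fun h j => StZero.middle hses (h.1 j) (h.2 j),
      fun h j => StZero.left hses (hT j) (h.1 j) (h.2 _)⟩

theorem isKillingStage_bot {X : Type} [AddCommGroup X] [Module A X] {D : ℤ → ModuleCat.{0} A}
    (hzero : ∀ i, i < 0 ∨ 1 < i → StZero A (D i) X) (h0 : StFin k A (D 0) X)
    (h1 : StFin k A (D 1) X) : IsKillingStage k D 0 (⊥ : Submodule A (X × (ℕ →₀ A))) := by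
  let e := Submodule.quotEquivOfEqBot (⊥ : Submodule A (X × (ℕ →₀ A))) rfl
  have hz : ∀ i, i < 0 ∨ 1 < i →
      StZero A (D i) ((X × (ℕ →₀ A)) ⧸ (⊥ : Submodule A (X × (ℕ →₀ A)))) := fun i hi =>
    ((hzero i hi).prod_right fun f => isNull_of_projective_right f).congr_right e.symm
  have hf : ∀ i, StFin k A (D i) X →
      StFin k A (D i) ((X × (ℕ →₀ A)) ⧸ (⊥ : Submodule A (X × (ℕ →₀ A)))) := by
    intro i hi
    refine hi.of_stable_retract (e.symm.toLinearMap ∘ₗ LinearMap.inl A X (ℕ →₀ A))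
      (LinearMap.fst A X (ℕ →₀ A) ∘ₗ e.toLinearMap)
      ⟨ℕ →₀ A, _, _, inferInstance, LinearMap.snd A X (ℕ →₀ A) ∘ₗ e.toLinearMap,
        e.symm.toLinearMap ∘ₗ LinearMap.inr A X (ℕ →₀ A), ?_⟩
    refine LinearMap.ext fun x => e.injective ?_
    simp only [LinearMap.sub_apply, LinearMap.comp_apply, LinearMap.id_apply, map_sub,
      LinearEquiv.coe_coe, LinearEquiv.apply_symm_apply]
    ext <;> simp
  refine ⟨Submodule.fg_bot, fun i hi => hz i (Or.inl hi), ⟨1, fun i hi => hz i (Or.inr hi)⟩, ?_⟩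
  intro i
  by_cases hi : i < 0 ∨ 1 < i
  · exact (hz i hi).stFin
  · obtain rfl | rfl : i = 0 ∨ i = 1 := by omega
    · exact hf 0 h0
    · exact hf 1 h1

theorem IsKillingStage.exists_seq {X : Type} [AddCommGroup X] [Module A X]
    [FiniteDimensional k A] [Module.Injective A A] [IsNoetherianRing A] {D : ℤ → ModuleCat.{0} A}
    (hfin : ∀ i, Module.Finite A (D i)) (hstep : ∀ i, IsStep A (D i) (D (i + 1)))
    (horth : ∀ i j, i < j ∨ j + 1 < i → StZero A (D i) (D j))
    {N₀ : Submodule A (X × (ℕ →₀ A))} (h : IsKillingStage k D 0 N₀) :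
    ∃ N : ℕ → Submodule A (X × (ℕ →₀ A)), N 0 = N₀ ∧
      ∀ n, (N n).FG ∧ IsKillingStep D n (N n) (N (n + 1)) := by
  choose next hnext using fun n (N : {N // IsKillingStage (E := X × (ℕ →₀ A)) k D n N}) =>
    N.2.exists_isKillingStep hfin hstep horth
  let N : ∀ n, {N // IsKillingStage (E := X × (ℕ →₀ A)) k D n N} := fun n =>
    Nat.rec ⟨N₀, h⟩ (fun n N => ⟨next n N, (hnext n N).1⟩) n
  exact ⟨fun n => (N n).1, rfl, fun n => ⟨(N n).2.fg, (hnext n (N n)).2⟩⟩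

/-- The union of a killing sequence has a quotient without stable maps from the `D i`. -/
theorem stZero_quotient_iSup {E : Type} [AddCommGroup E] [Module A E] [IsNoetherianRing A]
    {D : ℤ → ModuleCat.{0} A}
    (hfin : ∀ i, Module.Finite A (D i)) {N : ℕ → Submodule A E}
    (hN : ∀ n, IsKillingStep D n (N n) (N (n + 1))) (i : ℤ) :
    StZero A (D i) (E ⧸ ⨆ n, N n) := fun f => by
  have hmono : Monotone N := monotone_nat_of_le_succ fun n => (hN n).le
  have := hfin i
  obtain ⟨n, g, rfl⟩ := exists_factor_comp_eq hmono f
  have : Submodule.factor (le_iSup N n) =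
      Submodule.factor (le_iSup N (n + 1)) ∘ₗ Submodule.factor (hN n).le := by
    ext; rfl
  rw [this, LinearMap.comp_assoc]
  exact ((hN n).isNull_comp i g).comp _

end KillingFiltration

section CosyzygyFiltration

variable {k A : Type} [Field k] [Ring A] [Algebra k A]

/-- An exhausting-up-to-projectives filtration of `E` by finitely generated submodules whose
`n`-th subquotient is a finite direct sum of modules `C t` with `n ≤ t`. -/
structure IsCosyzygyFiltration {E : Type} [AddCommGroup E] [Module A E] (C : ℕ → ModuleCat.{0} A)
    (N : ℕ → Submodule A E) : Prop where
  mono : Monotone N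
  zero : N 0 = ⊥
  fg : ∀ n, (N n).FG
  exists_equiv : ∀ n, ∃ (ι : Type) (_ : Fintype ι) (T : ι → ℕ), (∀ j, n ≤ T j) ∧
    Nonempty ((N (n + 1) ⧸ (N n).comap (N (n + 1)).subtype) ≃ₗ[A] ((j : ι) → C (T j)))
  projective : Module.Projective A (E ⧸ ⨆ n, N n)

theorem exists_isCosyzygyFiltration [FiniteDimensional k A] [Module.Injective A A]
    {M : ModuleCat.{0} A} [Module.Finite A M] (hso : SelfOrthogonal A M)
    (hns : NakayamaStable k A M) {C : ℕ → ModuleCat.{0} A} (hC : IsMinInjCoresolution A M C)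
    {X : ModuleCat.{0} A} (hE : MemE k A M (C 1) X) (hS : MemS A M X) :
    ∃ N : ℕ → Submodule A (X × (ℕ →₀ A)), IsCosyzygyFiltration C N := by
  have := IsNoetherianRing.of_finite k A
  have hfin := finite_extendLeft fun n => (hC.exists_isSES k n).1
  have hstep := isStep_extendLeft (hC.isStep k)
  have e : C 0 ≃ₗ[A] M := hC.1.some.toLinearEquiv
  have hbot : IsKillingStage k (extendLeft C) 0 (⊥ : Submodule A (X × (ℕ →₀ A))) :=
    isKillingStage_bot (fun i hi => hE.1.stZero hns hC hi)
      (hE.2.1.stFin.congr_left e) hE.2.2.stFin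
  obtain ⟨N, hN0, hN⟩ := hbot.exists_seq hfin hstep fun i j hij => stZero_extendLeft hso hns hC hij
  have hmono : Monotone N := monotone_nat_of_le_succ fun n => (hN n).2.le
  let Q : ModuleCat.{0} A := ModuleCat.of A ((X × (ℕ →₀ A)) ⧸ ⨆ n, N n)
  let T := extendLeft (cosyzygies k Q)
  have hT : ∀ i, IsStep A (T i) (T (i + 1)) := isStep_extendLeft (isStep_cosyzygies k Q)
  have hDT : ∀ i j, StZero A (extendLeft C i) (T j) := by
    intro i j
    have h0 : StZero A (extendLeft C (i - j)) (T 0) :=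
      stZero_quotient_iSup hfin (fun n => (hN n).2) (i - j)
    rwa [stZero_shift_int hstep hT _ _ j, sub_add_cancel, zero_add] at h0
  have hXT : ∀ j, StZero A X (T j) :=
    hS _ (isSClosedClass_stZero hT fun j => (hDT 0 j).congr_left e)
  have hET : ∀ j, StZero A (X × (ℕ →₀ A)) (T j) := fun j =>
    StZero.middle (i := LinearMap.inl A X (ℕ →₀ A)) (p := LinearMap.snd A X (ℕ →₀ A))
      ⟨LinearMap.inl_injective, Function.Exact.inl_snd, LinearMap.snd_surjective⟩ (hXT j)
      fun f => isNull_of_projective_left f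
  have hNT : ∀ j, StZero A ↥(⨆ n, N n) (T j) := by
    refine fun j => stZero_iSup hmono hN0 fun n => ?_
    obtain ⟨ι, _, t, -, ⟨e'⟩⟩ := (hN n).2.exists_equiv
    exact (StZero.pi_left fun l => hDT (t l : ℤ) j).congr_left e'.symm
  have hQ : StZero A Q (T (-1 + 1)) :=
    StZero.right (isSES_mkQ (⨆ n, N n)) (hT (-1)) (hNT _) (hET _)
  have hQ' : StZero A Q Q := hQ
  exact ⟨N, hmono, hN0, fun n => (hN n).1, fun n => (hN n).2.exists_equiv,
    (hQ' LinearMap.id).projective⟩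

theorem nonempty_prod_quotient_equiv {E : Type} [AddCommGroup E] [Module A E] (N : Submodule A E)
    [Module.Projective A (E ⧸ N)] : Nonempty (E ≃ₗ[A] N × (E ⧸ N)) := by
  obtain ⟨s, hs⟩ := Module.projective_lifting_property N.mkQ LinearMap.id N.mkQ_surjective
  have hs' : ∀ y, N.mkQ (s y) = y := LinearMap.congr_fun hs
  have hN : ∀ x : N, N.mkQ x = 0 := fun x => (Submodule.Quotient.mk_eq_zero N).mpr x.2
  refine ⟨(LinearEquiv.ofBijective (N.subtype.coprod s) ⟨?_, fun x => ?_⟩).symm⟩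
  · refine (injective_iff_map_eq_zero _).mpr ?_
    rintro ⟨x, y⟩ hxy
    simp only [LinearMap.coprod_apply, Submodule.subtype_apply] at hxy
    have hy : y = 0 := by
      have := congrArg N.mkQ hxy
      rwa [map_add, hN, hs', zero_add, map_zero] at this
    subst hy
    rw [map_zero, add_zero] at hxy
    exact Prod.ext (Subtype.ext hxy) rfl
  · have hx : x - s (N.mkQ x) ∈ N := by
      rw [← Submodule.Quotient.mk_eq_zero, ← Submodule.mkQ_apply, map_sub, hs', sub_self]
    exact ⟨(⟨_, hx⟩, N.mkQ x), by simp⟩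

theorem IsCosyzygyFiltration.mFiltered {E : Type} [AddCommGroup E] [Module A E]
    {C : ℕ → ModuleCat.{0} A} {N : ℕ → Submodule A E} (h : IsCosyzygyFiltration C N) :
    MFiltered A C (ModuleCat.of A ↥(⨆ n, N n)) := by
  refine ⟨fun n => (N n).comap (⨆ n, N n).subtype, fun n m hnm => Submodule.comap_mono (h.mono hnm),
    ?_, iSup_comap_subtype h.mono, fun n => ?_⟩
  · change (N 0).comap _ = ⊥
    rw [h.zero, Submodule.comap_bot, Submodule.ker_subtype]
  · obtain ⟨ι, _, T, -, ⟨e⟩⟩ := h.exists_equiv n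
    obtain ⟨e'⟩ := nonempty_comap_subquotient_equiv (N := N n) (le_iSup N (n + 1))
    let r := (Fintype.equivFin ι).symm
    exact ⟨_, fun j => some (T (r j)),
      ⟨e' ≪≫ₗ e ≪≫ₗ (LinearEquiv.piCongrLeft A (fun j => C (T j)) r).symm⟩⟩

end CosyzygyFiltration

section FiniteObjects

variable {A X Y Z P : Type} [Ring A] [AddCommGroup X] [Module A X] [AddCommGroup Y] [Module A Y]
  [AddCommGroup Z] [Module A Z] [AddCommGroup P] [Module A P]

theorem IsNull.exists_isNull_lift {f : X →ₗ[A] Y} (hf : IsNull f) {p : P →ₗ[A] Y}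
    (hp : Function.Surjective p) : ∃ g : X →ₗ[A] P, IsNull g ∧ p ∘ₗ g = f := by
  obtain ⟨Q, _, _, hQ, u, v, rfl⟩ := hf
  obtain ⟨w, hw⟩ := Module.projective_lifting_property p v hp
  exact ⟨w ∘ₗ u, ⟨Q, _, _, hQ, u, w, rfl⟩, by rw [← LinearMap.comp_assoc, hw]⟩

/-- The maps from `X` to `Y` that are finite sums of maps factoring through `M`. -/
def factorsThroughSubgroup (M X Y : Type) [AddCommGroup M] [Module A M] [AddCommGroup X]
    [Module A X] [AddCommGroup Y] [Module A Y] : AddSubgroup (X →ₗ[A] Y) :=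
  AddSubgroup.closure {f | ∃ (u : X →ₗ[A] M) (v : M →ₗ[A] Y), f = v ∘ₗ u}

variable {M : Type} [AddCommGroup M] [Module A M]

theorem comp_mem_factorsThroughSubgroup (u : X →ₗ[A] M) (v : M →ₗ[A] Y) :
    v ∘ₗ u ∈ factorsThroughSubgroup M X Y :=
  AddSubgroup.subset_closure ⟨u, v, rfl⟩

theorem pi_eq_sum_comp {ι : Type} [Fintype ι] [DecidableEq ι] {V : ι → Type}
    [∀ i, AddCommGroup (V i)] [∀ i, Module A (V i)] (u : X →ₗ[A] ∀ i, V i)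
    (v : (∀ i, V i) →ₗ[A] Y) :
    v ∘ₗ u = ∑ i, (v ∘ₗ LinearMap.single A V i) ∘ₗ (LinearMap.proj i ∘ₗ u) := by
  refine LinearMap.ext fun x => ?_
  simp only [LinearMap.sum_apply, LinearMap.comp_apply, LinearMap.proj_apply,
    LinearMap.single_apply, ← map_sum]
  congr 1
  exact (Finset.univ_sum_single (u x)).symm

theorem comp_pi_mem_factorsThroughSubgroup {ι : Type} [Fintype ι] (u : X →ₗ[A] ι → M)
    (v : (ι → M) →ₗ[A] Y) : v ∘ₗ u ∈ factorsThroughSubgroup M X Y := by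
  classical
  rw [pi_eq_sum_comp u v]
  exact sum_mem fun i _ => comp_mem_factorsThroughSubgroup _ _

theorem exists_pi_of_mem_factorsThroughSubgroup {f : X →ₗ[A] Y}
    (hf : f ∈ factorsThroughSubgroup M X Y) :
    ∃ (n : ℕ) (u : X →ₗ[A] (Fin n → M)) (v : (Fin n → M) →ₗ[A] Y), v ∘ₗ u = f := by
  have : ∃ (n : ℕ) (u : Fin n → X →ₗ[A] M) (v : Fin n → M →ₗ[A] Y), f = ∑ j, v j ∘ₗ u j := by
    induction hf using AddSubgroup.closure_induction with
    | mem f h =>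
      obtain ⟨u, v, rfl⟩ := h
      exact ⟨1, fun _ => u, fun _ => v, by simp⟩
    | zero => exact ⟨0, fun _ => 0, fun _ => 0, by simp⟩
    | add f g _ _ hf hg =>
      obtain ⟨n, u, v, rfl⟩ := hf
      obtain ⟨m, u', v', rfl⟩ := hg
      exact ⟨n + m, Fin.append u u', Fin.append v v', by simp [Fin.sum_univ_add]⟩
    | neg f _ hf =>
      obtain ⟨n, u, v, rfl⟩ := hf
      exact ⟨n, u, fun j => -v j, by ext; simp⟩
  obtain ⟨n, u, v, rfl⟩ := this
  exact ⟨n, LinearMap.pi u, LinearMap.lsum A (fun _ => M) ℕ v, by ext; simp⟩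

theorem IsNull.mem_factorsThroughSubgroup {M : ModuleCat.{0} A} (hgen : IsGen A M)
    [Module.Finite A Y] {f : X →ₗ[A] Y} (hf : IsNull f) : f ∈ factorsThroughSubgroup M X Y := by
  obtain ⟨d, p, hp⟩ := Module.Finite.exists_fin' A Y
  obtain ⟨g, rfl⟩ := hf.exists_lift hp
  obtain ⟨n, i, r, hir⟩ := hgen.exists_retract
  rw [pi_eq_sum_comp g p]
  refine sum_mem fun j _ => ?_
  have := comp_pi_mem_factorsThroughSubgroup (i ∘ₗ LinearMap.proj j ∘ₗ g)
    ((p ∘ₗ LinearMap.single A (fun _ => A) j) ∘ₗ r)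
  rwa [LinearMap.comp_assoc _ r, ← LinearMap.comp_assoc _ i r, hir, LinearMap.id_comp] at this

theorem IsCosyzygyFiltration.exists_isNull_range_le [Module.Finite A X] {E : Type}
    [AddCommGroup E] [Module A E]
    {C : ℕ → ModuleCat.{0} A} {N : ℕ → Submodule A E} (h : IsCosyzygyFiltration C N)
    (hX : ∀ n, 1 ≤ n → StZero A X (C n)) (f : X →ₗ[A] E) :
    ∃ u : X →ₗ[A] E, IsNull u ∧ LinearMap.range (f - u) ≤ N 1 := by
  have := h.projective
  obtain ⟨u, hu, hfu⟩ := (isNull_of_projective_right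
    ((⨆ n, N n).mkQ ∘ₗ f)).exists_isNull_lift (⨆ n, N n).mkQ_surjective
  have hfg : (LinearMap.range (f - u)).FG := Module.Finite.iff_fg.mp inferInstance
  obtain ⟨n, hn⟩ := hfg.exists_le_of_le_iSup h.mono (by
    rintro _ ⟨x, rfl⟩
    rw [← Submodule.Quotient.mk_eq_zero, ← Submodule.mkQ_apply, LinearMap.sub_apply, map_sub,
      sub_eq_zero]
    exact (LinearMap.congr_fun hfu x).symm)
  have hn' := hn.trans (h.mono (Nat.le_succ n))
  clear hn hfg hfu
  induction n generalizing u with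
  | zero => exact ⟨u, hu, hn'⟩
  | succ n ih =>
    obtain ⟨ι, _, T, hT, ⟨e⟩⟩ := h.exists_equiv (n + 1)
    let g := (f - u).codRestrict (N (n + 1 + 1)) fun x => hn' ⟨x, rfl⟩
    have hz : StZero A X (N (n + 1 + 1) ⧸ (N (n + 1)).comap (N (n + 1 + 1)).subtype) :=
      (StZero.pi_right fun j => hX (T j) (by have := hT j; omega)).congr_right e.symm
    obtain ⟨v, hv, hvg⟩ := (hz (Submodule.mkQ _ ∘ₗ g)).exists_isNull_lift (Submodule.mkQ_surjective _)
    refine ih (u + (N (n + 1 + 1)).subtype ∘ₗ v) (hu.add (hv.comp _)) ?_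
    rintro _ ⟨x, rfl⟩
    have hx := LinearMap.congr_fun hvg x
    rw [LinearMap.comp_apply, LinearMap.comp_apply, ← sub_eq_zero, ← map_sub, Submodule.mkQ_apply,
      Submodule.Quotient.mk_eq_zero] at hx
    have := (N (n + 1)).neg_mem hx
    simpa [g, sub_sub, sub_eq_add_neg, add_comm, add_left_comm, add_assoc] using this

theorem memAdd_of_id_eq_add {M X : ModuleCat.{0} A} [Module.Finite A X]
    (hgen : IsGen A M) {C : ℕ → ModuleCat.{0} A} (e₀ : C 0 ≃ₗ[A] M)
    (hX : ∀ n, 1 ≤ n → StZero A X (C n)) {ι : Type} [Fintype ι] (T : ι → ℕ)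
    (g : X →ₗ[A] ((j : ι) → C (T j))) (v : ((j : ι) → C (T j)) →ₗ[A] X) {w : X →ₗ[A] X}
    (hw : IsNull w) (hid : LinearMap.id = v ∘ₗ g + w) : MemAdd A M X := by
  classical
  have hmem : (LinearMap.id : X →ₗ[A] X) ∈ factorsThroughSubgroup M X X := by
    rw [hid, pi_eq_sum_comp]
    refine add_mem (sum_mem fun j _ => ?_) (hw.mem_factorsThroughSubgroup hgen)
    by_cases hj : 1 ≤ T j
    · exact ((hX (T j) hj _).comp _).mem_factorsThroughSubgroup hgen
    · have : Nonempty (C (T j) ≃ₗ[A] M) := by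
        rw [show T j = 0 by omega]
        exact ⟨e₀⟩
      obtain ⟨e⟩ := this
      have := comp_mem_factorsThroughSubgroup (e.toLinearMap ∘ₗ LinearMap.proj j ∘ₗ g)
        ((v ∘ₗ LinearMap.single A (fun j => C (T j)) j) ∘ₗ e.symm.toLinearMap)
      rwa [LinearMap.comp_assoc _ e.symm.toLinearMap,
        ← LinearMap.comp_assoc _ e.toLinearMap e.symm.toLinearMap,
        LinearEquiv.symm_comp, LinearMap.id_comp] at this
  obtain ⟨n, i, r, hir⟩ := exists_pi_of_mem_factorsThroughSubgroup hmem
  exact memAdd_of_retract i r hir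

theorem nonempty_equiv_quotient_comap_bot {E : Type} [AddCommGroup E] [Module A E]
    {N N' : Submodule A E} (h : N = ⊥) : Nonempty (N' ≃ₗ[A] N' ⧸ N.comap N'.subtype) :=
  ⟨(Submodule.quotEquivOfEqBot _ (by rw [h, Submodule.comap_bot, Submodule.ker_subtype])).symm⟩

theorem IsCosyzygyFiltration.memAdd {M X : ModuleCat.{0} A} [Module.Finite A X]
    (hgen : IsGen A M) {C : ℕ → ModuleCat.{0} A} (e₀ : C 0 ≃ₗ[A] M)
    {N : ℕ → Submodule A (X × (ℕ →₀ A))} (h : IsCosyzygyFiltration C N)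
    (hX : ∀ n, 1 ≤ n → StZero A X (C n)) : MemAdd A M X := by
  obtain ⟨u, hu, hle⟩ := h.exists_isNull_range_le hX (LinearMap.inl A X (ℕ →₀ A))
  obtain ⟨ι, _, T, -, ⟨e⟩⟩ := h.exists_equiv 0
  obtain ⟨e'⟩ := nonempty_equiv_quotient_comap_bot (N' := N (0 + 1)) h.zero
  let g : X →ₗ[A] N (0 + 1) :=
    (LinearMap.inl A X (ℕ →₀ A) - u).codRestrict (N (0 + 1)) fun x => hle ⟨x, rfl⟩
  refine memAdd_of_id_eq_add hgen e₀ hX T ((e' ≪≫ₗ e).toLinearMap ∘ₗ g)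
    (LinearMap.fst A X (ℕ →₀ A) ∘ₗ (N (0 + 1)).subtype ∘ₗ (e' ≪≫ₗ e).symm.toLinearMap)
    (hu.comp (LinearMap.fst A X (ℕ →₀ A))) (LinearMap.ext fun x => ?_)
  simp only [LinearMap.add_apply, LinearMap.comp_apply, LinearEquiv.coe_coe,
    LinearEquiv.symm_apply_apply, ← map_add]
  simp [g]

end FiniteObjects

section Compactness

variable {A : Type} [Ring A]

/-- The endomorphism of a coproduct projecting to the summands indexed by `s`. -/
noncomputable def sigmaTrunc {I : Type} [DecidableEq I] (Y : I → ModuleCat.{0} A) (s : Finset I) :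
    ↥(∐ Y) →ₗ[A] ↥(∐ Y) :=
  ∑ i ∈ s, (Limits.Sigma.ι Y i).hom ∘ₗ (Limits.Sigma.π Y i).hom

theorem exists_sigmaTrunc_apply {I : Type} [DecidableEq I] (Y : I → ModuleCat.{0} A) (x : ↥(∐ Y)) :
    ∃ s : Finset I, ∀ s', s ⊆ s' → sigmaTrunc Y s' x = x := by
  let L : Submodule A ↥(∐ Y) :=
    { carrier := {x | ∃ s : Finset I, ∀ s', s ⊆ s' → sigmaTrunc Y s' x = x}
      zero_mem' := ⟨∅, fun _ _ => map_zero _⟩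
      add_mem' := by
        rintro x y ⟨s, hs⟩ ⟨t, ht⟩
        exact ⟨s ∪ t, fun s' h => by
          rw [map_add, hs s' (Finset.union_subset_left h), ht s' (Finset.union_subset_right h)]⟩
      smul_mem' := by
        rintro a x ⟨s, hs⟩
        exact ⟨s, fun s' h => by rw [map_smul, hs s' h]⟩ }
  have hι : ∀ i (y : Y i), (Limits.Sigma.ι Y i).hom y ∈ L := by
    intro i y
    refine ⟨{i}, fun s' h => ?_⟩
    rw [sigmaTrunc, LinearMap.sum_apply, Finset.sum_eq_single i]
    · have := congrArg (fun f => (Limits.Sigma.ι Y i).hom (f.hom y)) (Limits.Sigma.ι_π_eq_id Y i)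
      exact this
    · intro j _ hj
      have := congrArg (fun f => (Limits.Sigma.ι Y j).hom (f.hom y))
        (Limits.Sigma.ι_π_of_ne Y hj.symm)
      refine this.trans ?_
      simp
    · exact fun hi => absurd (h (Finset.mem_singleton_self i)) hi
  have hzero : ModuleCat.ofHom L.mkQ = 0 := by
    refine Limits.Sigma.hom_ext _ _ fun i => ?_
    ext y
    exact (Submodule.Quotient.mk_eq_zero L).mpr (hι i y)
  have hx : L.mkQ x = 0 := LinearMap.congr_fun (congrArg ModuleCat.Hom.hom hzero) x
  exact (Submodule.Quotient.mk_eq_zero L).mp hx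

theorem exists_sigmaTrunc_eqOn {I : Type} [DecidableEq I] (Y : I → ModuleCat.{0} A) {N : Submodule A ↥(∐ Y)}
    (hN : N.FG) : ∃ s : Finset I, ∀ x ∈ N, sigmaTrunc Y s x = x := by
  choose s hs using exists_sigmaTrunc_apply Y
  obtain ⟨t, rfl⟩ := hN
  refine ⟨t.biUnion s, fun x hx => ?_⟩
  induction hx using Submodule.span_induction with
  | mem x h => exact hs x _ (Finset.subset_biUnion_of_mem s h)
  | zero => exact map_zero _
  | add x y _ _ hx hy => rw [map_add, hx, hy]
  | smul a x _ hx => rw [map_smul, hx]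

theorem stZero_sigma {W I : Type} [AddCommGroup W] [Module A W] [Module.Finite A W]
    {Y : I → ModuleCat.{0} A} (h : ∀ i, StZero A W (Y i)) : StZero A W ↥(∐ Y) := fun f => by
  classical
  obtain ⟨s, hs⟩ := exists_sigmaTrunc_eqOn Y (N := LinearMap.range f)
    (Module.Finite.iff_fg.mp inferInstance)
  have : f = ∑ i ∈ s, (Limits.Sigma.ι Y i).hom ∘ₗ (Limits.Sigma.π Y i).hom ∘ₗ f := by
    refine LinearMap.ext fun x => (hs (f x) ⟨x, rfl⟩).symm.trans ?_
    simp [sigmaTrunc]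
  rw [this]
  exact IsNull.sum s fun i _ => (h i _).comp _

theorem IsCosyzygyFiltration.exists_finset_isNull {X I : Type} [DecidableEq I] [AddCommGroup X] [Module A X]
    [IsNoetherianRing A] [Module.Injective A A]
    {C : ℕ → ModuleCat.{0} A} (hC : ∀ n, Module.Finite A (C n))
    {N : ℕ → Submodule A (X × (ℕ →₀ A))} (h : IsCosyzygyFiltration C N)
    {Y : I → ModuleCat.{0} A} (hY : ∀ i n, 2 ≤ n → StZero A (C n) (Y i))
    (g : X →ₗ[A] ↥(∐ Y)) : ∃ s : Finset I, IsNull (g - sigmaTrunc Y s ∘ₗ g) := by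
  obtain ⟨s, hs⟩ := exists_sigmaTrunc_eqOn Y ((h.fg 2).map (g ∘ₗ LinearMap.fst A X (ℕ →₀ A)))
  refine ⟨s, ?_⟩
  let f := (g - sigmaTrunc Y s ∘ₗ g) ∘ₗ LinearMap.fst A X (ℕ →₀ A)
  have hmono : Monotone fun n => N (n + 2) := fun n m hnm => h.mono (by omega)
  obtain ⟨u, hu, huf⟩ := exists_isNull_eq_on_iSup (F := fun n => N (n + 2)) (Y := ↥(∐ Y)) hmono
    (fun n => by
      obtain ⟨ι, _, T, hT, ⟨e⟩⟩ := h.exists_equiv (n + 2)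
      exact (StZero.pi_left fun j => stZero_sigma fun i =>
        hY i (T j) (by have := hT j; omega)).congr_left e.symm) f
    (fun x hx => by
      have := hs _ ⟨x, hx, rfl⟩
      simpa [f, sub_eq_zero] using this.symm)
  have hle : ⨆ n, N n ≤ ⨆ n, N (n + 2) :=
    iSup_le fun n => (h.mono (Nat.le_add_right n 2)).trans (le_iSup (fun n => N (n + 2)) n)
  obtain ⟨v, hv⟩ := (isSES_mkQ (⨆ n, N n)).exists_desc (f - u) (by
    ext x
    simp [huf x (hle x.2)])
  have := h.projective
  have hf : IsNull f := by
    have := ((isNull_of_projective_left v).precomp (⨆ n, N n).mkQ).add hu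
    rwa [hv, sub_add_cancel] at this
  exact hf.precomp (LinearMap.inl A X (ℕ →₀ A))

theorem memAddBig_finsupp (M : ModuleCat.{0} A) (I : Type) :
    MemAddBig A M (ModuleCat.of A (I →₀ M)) :=
  ⟨I, ModuleCat.of A PUnit, ⟨LinearEquiv.prodUnique⟩⟩

theorem IsGen.exists_surjective {M : ModuleCat.{0} A} (hgen : IsGen A M) (Y : ModuleCat.{0} A) :
    ∃ (I : Type) (p : (I →₀ M) →ₗ[A] Y), Function.Surjective p := by
  classical
  obtain ⟨n, i, r, hir⟩ := hgen.exists_retract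
  refine ⟨M →ₗ[A] Y, Finsupp.lsum ℕ fun f => f, fun y => ?_⟩
  have hy : ∑ j : Fin n, ((LinearMap.toSpanSingleton A Y y ∘ₗ r) ∘ₗ
      LinearMap.single A (fun _ => (M : Type)) j) (i (1 : A) j) = y := by
    have h1 := congrArg (fun f => f (1 : A))
      (pi_eq_sum_comp i (LinearMap.toSpanSingleton A Y y ∘ₗ r))
    rw [LinearMap.comp_assoc, hir] at h1
    simpa using h1.symm
  refine ⟨∑ j : Fin n, Finsupp.single ((LinearMap.toSpanSingleton A Y y ∘ₗ r) ∘ₗ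
      LinearMap.single A (fun _ => (M : Type)) j) (i (1 : A) j), ?_⟩
  rw [map_sum]
  refine Eq.trans (Finset.sum_congr rfl fun j _ => ?_) hy
  simp

theorem IsNull.mem_addMSub {M X Y : ModuleCat.{0} A} (hgen : IsGen A M) {f : X ⟶ Y}
    (hf : IsNull f.hom) : f ∈ addMSub A M X Y := by
  obtain ⟨I, p, hp⟩ := hgen.exists_surjective Y
  obtain ⟨g, hg⟩ := hf.exists_lift hp
  refine AddSubgroup.subset_closure ⟨_, memAddBig_finsupp M I, ModuleCat.ofHom g,
    ModuleCat.ofHom p, ?_⟩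
  ext x
  exact (LinearMap.congr_fun hg x).symm

/-- The class of a morphism modulo the maps factoring through a module in `Add(M)`. -/
def stMk (M X Y : ModuleCat.{0} A) : (X ⟶ Y) →+ StHomM A M X Y :=
  QuotientAddGroup.mk' (addMSub A M X Y)

theorem stMk_surjective (M X Y : ModuleCat.{0} A) : Function.Surjective (stMk M X Y) :=
  QuotientAddGroup.mk'_surjective _

theorem stMk_eq_zero {M X Y : ModuleCat.{0} A} {f : X ⟶ Y} (hf : f ∈ addMSub A M X Y) :
    stMk M X Y f = 0 :=
  (QuotientAddGroup.eq_zero_iff f).mpr hf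

theorem stPostComp_stMk {M X Y Z : ModuleCat.{0} A} (f : X ⟶ Y) (h : Y ⟶ Z) :
    stPostComp A M X h (stMk M X Y f) = stMk M X Z (f ≫ h) :=
  rfl

theorem stCanonMap_of {M X : ModuleCat.{0} A} {I : Type} [DecidableEq I] (Y : I → ModuleCat.{0} A)
    (i : I) (x : StHomM A M X (Y i)) :
    stCanonMap A M X I Y (DirectSum.of (fun i => StHomM A M X (Y i)) i x) =
      stPostComp A M X (Limits.Sigma.ι Y i) x := by
  rw [stCanonMap, Subsingleton.elim (Classical.decEq I) ‹DecidableEq I›]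
  exact DirectSum.toAddMonoid_of (fun i => stPostComp A M X (Limits.Sigma.ι Y i)) i x

theorem stPostComp_comp_stCanonMap {M X : ModuleCat.{0} A} {I : Type} [DecidableEq I]
    (Y : I → ModuleCat.{0} A) (i : I) (x : DirectSum I fun i => StHomM A M X (Y i)) :
    stPostComp A M X (Limits.Sigma.π Y i) (stCanonMap A M X I Y x) = x i := by
  induction x using DirectSum.induction_on with
  | zero => rw [map_zero, map_zero]; rfl
  | add x y hx hy => rw [map_add, map_add, hx, hy]; rfl
  | of j x =>
    obtain ⟨f, rfl⟩ := stMk_surjective _ _ _ x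
    have h1 := stCanonMap_of Y j (stMk M X (Y j) f)
    refine (congrArg (stPostComp A M X (Limits.Sigma.π Y i)) h1).trans ?_
    rw [stPostComp_stMk, stPostComp_stMk, Category.assoc]
    by_cases hij : j = i
    · subst hij
      rw [Limits.Sigma.ι_π_eq_id, Category.comp_id, DirectSum.of_eq_same]
    · rw [Limits.Sigma.ι_π_of_ne Y hij, Limits.comp_zero, map_zero,
        DirectSum.of_eq_of_ne _ _ _ (Ne.symm hij)]

theorem IsCosyzygyFiltration.mCompact {M X : ModuleCat.{0} A}
    [IsNoetherianRing A] [Module.Injective A A] (hgen : IsGen A M) (hX : MemG A M X)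
    {C : ℕ → ModuleCat.{0} A} (hC : ∀ n, Module.Finite A (C n))
    {N : ℕ → Submodule A (X × (ℕ →₀ A))} (h : IsCosyzygyFiltration C N)
    (hG : ∀ Y : ModuleCat.{0} A, MemG A M Y → ∀ n, 2 ≤ n → StZero A (C n) Y) :
    MCompact A M X := by
  classical
  refine ⟨hX, fun I Y hY => ⟨(injective_iff_map_eq_zero _).mpr fun x hx => ?_, fun y => ?_⟩⟩
  · refine DFinsupp.ext fun i => ?_
    exact (stPostComp_comp_stCanonMap Y i x).symm.trans (by rw [hx, map_zero]; rfl)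
  · obtain ⟨g, rfl⟩ := stMk_surjective _ _ _ y
    obtain ⟨s, hs⟩ := h.exists_finset_isNull hC (fun i => hG (Y i) (hY i)) g.hom
    refine ⟨∑ i ∈ s, DirectSum.of (fun i => StHomM A M X (Y i)) i
      (stMk M X (Y i) (g ≫ Limits.Sigma.π Y i)), ?_⟩
    rw [map_sum, Finset.sum_congr rfl fun i _ => stCanonMap_of Y i _]
    simp only [stPostComp_stMk]
    rw [← map_sum, eq_comm, ← sub_eq_zero, ← map_sub]
    refine stMk_eq_zero (IsNull.mem_addMSub hgen ?_)
    convert hs using 1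
    ext x
    simp [sigmaTrunc]

end Compactness

/-- **Proposition 1.6(1)**. Every `X ∈ ℰ ∩ 𝒮` is `M`-compact and stably isomorphic to an
`M`-filtered module; moreover `X ∈ ℰ ∩ 𝒮` is finitely generated iff `X ∈ add M`.
Here `C` is the cosyzygy sequence of `M` along a minimal injective coresolution, so that
`C 1 = Ω_A^{-1}(M)`. -/
theorem mem_E_inter_S_M_compact_and_M_filtered
    (k A : Type) [Field k] [Ring A] [Algebra k A] [FiniteDimensional k A]
    [Module.Injective A A]
    (M : ModuleCat.{0} A) [Module.Finite A ↥M]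
    (hgen : IsGen A M) (hso : SelfOrthogonal A M) (hns : NakayamaStable k A M)
    (C : ℕ → ModuleCat.{0} A) (hC : IsMinInjCoresolution A M C) :
    ∀ X : ModuleCat.{0} A, MemE k A M (C 1) X → MemS A M X →
      MCompact A M X ∧
      (∃ (X' P Q : ModuleCat.{0} A), MFiltered A C X' ∧ Module.Projective A ↥P ∧
        Module.Projective A ↥Q ∧ Nonempty ((↥X × ↥P) ≃ₗ[A] (↥X' × ↥Q))) ∧
      (Module.Finite A ↥X ↔ MemAdd A M X) := by
  intro X hE hS
  have := IsNoetherianRing.of_finite k A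
  obtain ⟨N, hN⟩ := exists_isCosyzygyFiltration hso hns hC hE hS
  refine ⟨hN.mCompact hgen hE.1 (fun n => (hC.exists_isSES k n).1) fun Y hY n hn =>
    hY.stZero hns hC (i := (n : ℤ)) (Or.inr (by omega)), ?_, fun _ => ?_, fun h => ?_⟩
  · exact ⟨ModuleCat.of A ↥(⨆ n, N n), ModuleCat.of A (ℕ →₀ A), ModuleCat.of A (_ ⧸ ⨆ n, N n),
      hN.mFiltered, inferInstanceAs (Module.Projective A (ℕ →₀ A)), hN.projective,
      have := hN.projective
      nonempty_prod_quotient_equiv _⟩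
  · exact hN.memAdd hgen hC.1.some.toLinearEquiv fun n hn =>
      stZero_cosyzygy k hC hn (hE.1 n hn).2
  · obtain ⟨n, i, r, hir⟩ := h.exists_retract
    exact Module.Finite.of_surjective r fun x => ⟨i x, LinearMap.congr_fun hir x⟩
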